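/- arXiv:2403.04396 — 6 statements merged into one kernel-verified Lean document; each statement's English description precedes it below -/
import Mathlib

section
/- The function û_λ is twice continuously differentiable on ℝ, satisfies û_λ''(x) + λ·û_λ(x) − a·û_λ(x)^p = 0 for all x ∈ ℝ, is nonnegative, satisfies û_λ(x) > 0 if and only if x ∈ (−T_H(λ), T_H(λ)), has û_λ'(0) = 0, and attains its maximum value u_H(λ) exactly at x = 0. -/
/-- The extinction time `T_H(λ) = π/((1-p)·√λ)`. -/
noncomputable def TH (p lam : ℝ) : ℝ := Real.pi / ((1 - p) * Real.sqrt lam)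

/-- The maximum value `u_H(λ) = (2a/((p+1)λ))^{1/(1-p)}` of the degenerate homoclinic. -/
noncomputable def uH (a p lam : ℝ) : ℝ := (2 * a / ((p + 1) * lam)) ^ (1 / (1 - p))

/-- The degenerate homoclinic solution `û_λ`. -/
noncomputable def uhat (a p lam x : ℝ) : ℝ :=
  if |x| ≤ TH p lam then
    uH a p lam * Real.cos ((1 - p) * Real.sqrt lam * x / 2) ^ (2 / (1 - p))
  else 0

/-- The cosine, truncated to zero outside `[-π/2, π/2]`. -/
noncomputable def truncCos (x : ℝ) : ℝ := if |x| ≤ Real.pi / 2 then Real.cos x else 0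

lemma truncCos_of_le {x : ℝ} (hx : |x| ≤ Real.pi / 2) : truncCos x = Real.cos x := if_pos hx

lemma truncCos_of_ge {x : ℝ} (hx : Real.pi / 2 ≤ |x|) : truncCos x = 0 := by
  rcases hx.eq_or_lt with h | h
  · rw [truncCos_of_le h.ge, ← Real.cos_abs, ← h, Real.cos_pi_div_two]
  · exact if_neg h.not_ge

lemma truncCos_zero : truncCos 0 = 1 := by
  rw [truncCos_of_le (by simpa using Real.pi_div_two_pos.le), Real.cos_zero]

lemma truncCos_pos_iff {x : ℝ} : 0 < truncCos x ↔ |x| < Real.pi / 2 := by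
  refine ⟨fun h => ?_, fun h => ?_⟩
  · by_contra! hx
    exact h.ne' (truncCos_of_ge hx)
  · rw [truncCos_of_le h.le]
    exact Real.cos_pos_of_mem_Ioo (abs_lt.1 h)

lemma truncCos_nonneg (x : ℝ) : 0 ≤ truncCos x := by
  rcases lt_or_ge |x| (Real.pi / 2) with h | h
  · exact (truncCos_pos_iff.2 h).le
  · exact (truncCos_of_ge h).ge

lemma truncCos_lt_one {x : ℝ} (hx : x ≠ 0) : truncCos x < 1 := by
  rcases lt_or_ge |x| (Real.pi / 2) with h | h
  · rw [truncCos_of_le h.le, ← Real.cos_abs, ← Real.cos_zero]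
    exact Real.cos_lt_cos_of_nonneg_of_le_pi_div_two le_rfl h.le (abs_pos.2 hx)
  · rw [truncCos_of_ge h]
    exact one_pos

lemma truncCos_mul_cos (x : ℝ) : truncCos x * Real.cos x = truncCos x ^ 2 := by
  rcases le_total |x| (Real.pi / 2) with h | h
  · rw [truncCos_of_le h, sq]
  · simp [truncCos_of_ge h]

lemma continuous_truncCos : Continuous truncCos := by
  refine Continuous.if_le Real.continuous_cos continuous_const continuous_abs continuous_const ?_
  intro x hx
  rw [← Real.cos_abs, hx, Real.cos_pi_div_two]

lemma truncCos_eq_max {x : ℝ} (hx : |x| < Real.pi + Real.pi / 2) :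
    truncCos x = max (Real.cos x) 0 := by
  rcases le_total |x| (Real.pi / 2) with h | h
  · rw [truncCos_of_le h, max_eq_left (Real.cos_nonneg_of_mem_Icc (abs_le.1 h))]
  · rw [truncCos_of_ge h, max_eq_right]
    rw [← Real.cos_abs]
    exact Real.cos_nonpos_of_pi_div_two_le_of_le h hx.le

lemma hasDerivAt_max_zero_rpow {r : ℝ} (hr : 1 < r) (y : ℝ) :
    HasDerivAt (fun y : ℝ => max y 0 ^ r) (r * max y 0 ^ (r - 1)) y := by
  have hright : ∀ z : ℝ, HasDerivAt (fun z : ℝ => z ^ r) (r * z ^ (r - 1)) z :=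
    fun z => Real.hasDerivAt_rpow_const (Or.inr hr.le)
  have hr0 : r ≠ 0 := by linarith
  have hr1 : r - 1 ≠ 0 := by linarith
  rcases lt_trichotomy y 0 with h | rfl | h
  · have hd : HasDerivAt (fun _ : ℝ => (0 : ℝ)) 0 y := hasDerivAt_const y 0
    rw [max_eq_right h.le, Real.zero_rpow hr1, mul_zero]
    refine hd.congr_of_eventuallyEq ?_
    filter_upwards [eventually_lt_nhds h] with z hz
    rw [max_eq_right hz.le, Real.zero_rpow hr0]
  · have h0 : r * max (0 : ℝ) 0 ^ (r - 1) = 0 := by simp [Real.zero_rpow hr1]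
    rw [h0, ← hasDerivWithinAt_univ, ← Set.Iic_union_Ici (a := (0 : ℝ))]
    refine HasDerivWithinAt.union ?_ ?_
    · refine (hasDerivWithinAt_const (0 : ℝ) (Set.Iic 0) (0 : ℝ)).congr (fun z hz => ?_) ?_
      · rw [max_eq_right hz, Real.zero_rpow hr0]
      · simp [Real.zero_rpow hr0]
    · have hd := (hright 0).hasDerivWithinAt (s := Set.Ici 0)
      rw [Real.zero_rpow hr1, mul_zero] at hd
      refine hd.congr (fun z hz => ?_) ?_
      · rw [max_eq_left hz]
      · simp
  · rw [max_eq_left h.le]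
    refine (hright y).congr_of_eventuallyEq ?_
    filter_upwards [eventually_gt_nhds h] with z hz
    rw [max_eq_left hz.le]

lemma hasDerivAt_truncCos_rpow {r : ℝ} (hr : 1 < r) (x : ℝ) :
    HasDerivAt (fun x => truncCos x ^ r) (-(r * truncCos x ^ (r - 1) * Real.sin x)) x := by
  rcases lt_or_ge |x| (Real.pi + Real.pi / 2) with h | h
  · have hd := (hasDerivAt_max_zero_rpow hr (Real.cos x)).comp x (Real.hasDerivAt_cos x)
    rw [← truncCos_eq_max h, mul_neg] at hd
    refine hd.congr_of_eventuallyEq ?_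
    filter_upwards [continuous_abs.continuousAt.eventually_lt_const h] with z hz
    simp only [Function.comp_apply, truncCos_eq_max hz]
  · have h' : Real.pi / 2 < |x| := by linarith [Real.pi_pos]
    rw [truncCos_of_ge h'.le, Real.zero_rpow (by linarith), mul_zero, zero_mul, neg_zero]
    refine (hasDerivAt_const x (0 : ℝ)).congr_of_eventuallyEq ?_
    filter_upwards [continuous_abs.continuousAt.eventually_const_lt h'] with z hz
    rw [truncCos_of_ge hz.le, Real.zero_rpow (by linarith)]

lemma hasDerivAt_truncCos_rpow_mul_sin {r : ℝ} (hr : 2 < r) (x : ℝ) :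
    HasDerivAt (fun x => -(r * truncCos x ^ (r - 1) * Real.sin x))
      (r * (r - 1) * truncCos x ^ (r - 2) - r ^ 2 * truncCos x ^ r) x := by
  have hd := (((hasDerivAt_truncCos_rpow (show 1 < r - 1 by linarith) x).const_mul r).mul
    (Real.hasDerivAt_sin x)).neg
  refine hd.congr_deriv ?_
  have h1 : truncCos x ^ (r - 1) = truncCos x ^ (r - 2) * truncCos x := by
    rw [← Real.rpow_add_one' (truncCos_nonneg x) (by linarith)]
    congr 1
    ring
  have h2 : truncCos x ^ r = truncCos x ^ (r - 2) * truncCos x ^ 2 := by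
    rw [← Real.rpow_add_natCast' (truncCos_nonneg x) (by push_cast; linarith)]
    congr 1
    push_cast
    ring
  have h3 : truncCos x ^ (r - 2) * Real.cos x ^ 2 = truncCos x ^ (r - 2) * truncCos x ^ 2 := by
    rcases le_total |x| (Real.pi / 2) with h | h
    · rw [truncCos_of_le h]
    · rw [truncCos_of_ge h, Real.zero_rpow (by linarith), zero_mul, zero_mul]
  rw [show r - 1 - 1 = r - 2 by ring, h1, h2]
  linear_combination r * (r - 1) * truncCos x ^ (r - 2) * Real.sin_sq_add_cos_sq x -
    r * (r - 1) * h3 - r * truncCos x ^ (r - 2) * truncCos_mul_cos x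

lemma uhat_eq {p lam : ℝ} (a : ℝ) (hp1 : p < 1) (hlam : 0 < lam) (x : ℝ) :
    uhat a p lam x =
      uH a p lam * truncCos ((1 - p) * Real.sqrt lam / 2 * x) ^ (2 / (1 - p)) := by
  have hk : 0 < (1 - p) * Real.sqrt lam := mul_pos (by linarith) (Real.sqrt_pos.2 hlam)
  have hr : 2 / (1 - p) ≠ 0 := (div_pos two_pos (by linarith)).ne'
  have harg : (1 - p) * Real.sqrt lam * x / 2 = (1 - p) * Real.sqrt lam / 2 * x := by ring
  have hiff : |x| ≤ TH p lam ↔ |(1 - p) * Real.sqrt lam / 2 * x| ≤ Real.pi / 2 := by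
    rw [TH, le_div_iff₀ hk, abs_mul, abs_of_pos (half_pos hk)]
    constructor <;> intro h <;> linarith
  rw [uhat, truncCos, harg]
  split_ifs with h1 h2 h2
  · rfl
  · exact absurd (hiff.1 h1) h2
  · exact absurd (hiff.2 h2) h1
  · rw [Real.zero_rpow hr, mul_zero]

lemma contDiff_two_of_hasDerivAt {f f' f'' : ℝ → ℝ} (hf : ∀ x, HasDerivAt f (f' x) x)
    (hf' : ∀ x, HasDerivAt f' (f'' x) x) (hc : Continuous f'') : ContDiff ℝ 2 f := by
  rw [show (2 : WithTop ℕ∞) = 1 + 1 by norm_num, contDiff_succ_iff_deriv]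
  refine ⟨fun x => (hf x).differentiableAt, by simp, ?_⟩
  rw [deriv_eq hf, contDiff_one_iff_deriv, deriv_eq hf']
  exact ⟨fun x => (hf' x).differentiableAt, hc⟩

lemma uH_pos {a p lam : ℝ} (ha : 0 < a) (hp0 : 0 < p) (hlam : 0 < lam) : 0 < uH a p lam :=
  Real.rpow_pos_of_pos (by positivity) _

lemma mul_uH_eq {a p lam : ℝ} (ha : 0 < a) (hp0 : 0 < p) (hp1 : p < 1) (hlam : 0 < lam) :
    lam * (1 + p) / 2 * uH a p lam = a * uH a p lam ^ p := by
  have hU := uH_pos ha hp0 hlam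
  have hpow : uH a p lam ^ (1 - p) = 2 * a / ((p + 1) * lam) := by
    rw [uH, ← Real.rpow_mul (by positivity), one_div_mul_cancel (by linarith), Real.rpow_one]
  have hsplit : uH a p lam = uH a p lam ^ (1 - p) * uH a p lam ^ p := by
    rw [← Real.rpow_add hU, sub_add_cancel, Real.rpow_one]
  rw [hpow] at hsplit
  have hp' : p + 1 ≠ 0 := by linarith
  calc lam * (1 + p) / 2 * uH a p lam
      = lam * (1 + p) / 2 * (2 * a / ((p + 1) * lam) * uH a p lam ^ p) := by rw [← hsplit]
    _ = a * uH a p lam ^ p := by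
        field_simp
        ring

theorem stmt2 (a p lam : ℝ) (ha : 0 < a) (hp0 : 0 < p) (hp1 : p < 1) (hlam : 0 < lam) :
    ContDiff ℝ 2 (uhat a p lam) ∧
    (∀ x : ℝ,
      deriv (deriv (uhat a p lam)) x + lam * uhat a p lam x - a * uhat a p lam x ^ p = 0) ∧
    (∀ x : ℝ, 0 ≤ uhat a p lam x) ∧
    (∀ x : ℝ, 0 < uhat a p lam x ↔ x ∈ Set.Ioo (-(TH p lam)) (TH p lam)) ∧
    deriv (uhat a p lam) 0 = 0 ∧
    uhat a p lam 0 = uH a p lam ∧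
    (∀ x : ℝ, x ≠ 0 → uhat a p lam x < uH a p lam) := by
  have hq : 0 < 1 - p := by linarith
  have hk : 0 < (1 - p) * Real.sqrt lam := mul_pos hq (Real.sqrt_pos.2 hlam)
  have hU := uH_pos ha hp0 hlam
  have hode := mul_uH_eq ha hp0 hp1 hlam
  have hu := uhat_eq a hp1 hlam
  have hb : 0 < (1 - p) * Real.sqrt lam / 2 := half_pos hk
  have hr : 2 < 2 / (1 - p) := by
    rw [lt_div_iff₀ hq]
    linarith
  have hbr : ((1 - p) * Real.sqrt lam / 2 * (2 / (1 - p))) ^ 2 = lam := by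
    rw [show (1 - p) * Real.sqrt lam / 2 * (2 / (1 - p)) = Real.sqrt lam by field_simp,
      Real.sq_sqrt hlam.le]
  have hr_one : 2 / (1 - p) - 1 = 2 / (1 - p) * ((1 + p) / 2) := by
    field_simp
    ring
  have hr_two : 2 / (1 - p) - 2 = 2 / (1 - p) * p := by
    field_simp
    ring
  set b := (1 - p) * Real.sqrt lam / 2 with hb_def
  set r := 2 / (1 - p)
  set U := uH a p lam
  have hlin : ∀ x : ℝ, HasDerivAt (fun x => b * x) b x := fun x => by
    simpa using (hasDerivAt_id x).const_mul b
  have hd1 : ∀ x, HasDerivAt (uhat a p lam)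
      (U * (-(r * truncCos (b * x) ^ (r - 1) * Real.sin (b * x)) * b)) x := fun x => by
    rw [funext hu]
    exact ((hasDerivAt_truncCos_rpow (by linarith) (b * x)).comp x (hlin x)).const_mul U
  have hd2 : ∀ x, HasDerivAt
      (fun x => U * (-(r * truncCos (b * x) ^ (r - 1) * Real.sin (b * x)) * b))
      (U * ((r * (r - 1) * truncCos (b * x) ^ (r - 2) - r ^ 2 * truncCos (b * x) ^ r) * b * b))
      x := fun x =>
    (((hasDerivAt_truncCos_rpow_mul_sin hr (b * x)).comp x (hlin x)).mul_const b).const_mul U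
  have hcont : ∀ s : ℝ, 0 ≤ s → Continuous fun x => truncCos (b * x) ^ s := fun s hs =>
    (continuous_truncCos.comp (continuous_const.mul continuous_id)).rpow_const
      fun _ => Or.inr hs
  have hcont_two := hcont (r - 2) (by linarith)
  have hcont_r := hcont r (by linarith)
  refine ⟨contDiff_two_of_hasDerivAt hd1 hd2 (by fun_prop), fun x => ?_, fun x => ?_, fun x => ?_,
    ?_, ?_, fun x hx => ?_⟩
  · rw [deriv_eq hd1, (hd2 x).deriv, hu,
      Real.mul_rpow hU.le (Real.rpow_nonneg (truncCos_nonneg _) _),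
      ← Real.rpow_mul (truncCos_nonneg _), hr_two, hr_one]
    linear_combination (U * ((1 + p) / 2) * truncCos (b * x) ^ (r * p) -
      U * truncCos (b * x) ^ r) * hbr + truncCos (b * x) ^ (r * p) * hode
  · rw [hu]
    exact mul_nonneg hU.le (Real.rpow_nonneg (truncCos_nonneg _) _)
  · have hpos : 0 < truncCos (b * x) ^ r ↔ 0 < truncCos (b * x) := by
      refine ⟨fun h => (truncCos_nonneg _).lt_of_ne fun h0 => ?_, fun h => Real.rpow_pos_of_pos h r⟩
      rw [← h0, Real.zero_rpow (by linarith)] at h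
      exact h.false
    rw [hu, mul_pos_iff_of_pos_left hU, hpos, truncCos_pos_iff, Set.mem_Ioo, ← abs_lt,
      TH, lt_div_iff₀ hk,
      abs_mul, abs_of_pos hb, hb_def]
    constructor <;> intro h <;> linarith
  · rw [(hd1 0).deriv]
    simp
  · rw [hu, mul_zero, truncCos_zero, Real.one_rpow, mul_one]
  · rw [hu]
    refine mul_lt_of_lt_one_right hU (Real.rpow_lt_one (truncCos_nonneg _) ?_ (by linarith))
    exact truncCos_lt_one (mul_ne_zero hb.ne' hx)
end

section
/- The Cauchy problem u''(x) + λ·u(x) − a·u(x)^p = 0 on ℝ with initial conditions u(0) = 0 and u'(0) = 0 has at least two distinct twice continuously differentiable nonnegative solutions: the identically zero function and the nonzero function x ↦ û_λ(x − T_H(λ)). In particular, there exists a nonzero C² function u : ℝ → ℝ with u ≥ 0, u(0) = u'(0) = 0, solving the equation on all of ℝ. -/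
/-- A nonnegative C² solution of the Cauchy problem
`u'' + λu - a u^p = 0`, `u(0) = 0`, `u'(0) = 0` on all of `ℝ`. -/
def SolvesCauchy (a p lam : ℝ) (u : ℝ → ℝ) : Prop :=
  ContDiff ℝ 2 u ∧ (∀ x : ℝ, 0 ≤ u x) ∧ u 0 = 0 ∧ deriv u 0 = 0 ∧
  ∀ x : ℝ, deriv (deriv u) x + lam * u x - a * u x ^ p = 0

/-- The function `cos (k x)` restricted to its central positivity interval and extended by zero. -/
noncomputable def cutCos (k x : ℝ) : ℝ :=
  if |x| ≤ Real.pi / (2 * k) then Real.cos (k * x) else 0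

lemma abs_mul_le_pi_div_two_iff {k x : ℝ} (hk : 0 < k) :
    |x| ≤ Real.pi / (2 * k) ↔ |k * x| ≤ Real.pi / 2 := by
  rw [abs_mul, abs_of_pos hk, le_div_iff₀ (by positivity), le_div_iff₀ two_pos]
  constructor <;> intro h <;> linarith

lemma cutCos_nonneg {k : ℝ} (hk : 0 < k) (x : ℝ) : 0 ≤ cutCos k x := by
  unfold cutCos
  split_ifs with h
  · rw [abs_mul_le_pi_div_two_iff hk, abs_le] at h
    exact Real.cos_nonneg_of_neg_pi_div_two_le_of_le h.1 h.2
  · rfl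

lemma continuous_cutCos {k : ℝ} (hk : 0 < k) : Continuous (cutCos k) := by
  unfold cutCos
  refine Continuous.if_le (by fun_prop) continuous_const continuous_abs continuous_const ?_
  intro x hx
  rw [← Real.cos_abs, abs_mul, abs_of_pos hk, hx,
    show k * (Real.pi / (2 * k)) = Real.pi / 2 by field_simp, Real.cos_pi_div_two]

lemma cutCos_mul_cos (k x : ℝ) : cutCos k x * Real.cos (k * x) = cutCos k x ^ 2 := by
  unfold cutCos
  split_ifs <;> ring

lemma abs_cutCos_le (k x : ℝ) : |cutCos k x| ≤ |Real.cos (k * x)| := by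
  unfold cutCos
  split_ifs <;> simp

lemma hasDerivAt_cutCos_rpow {k r : ℝ} (hk : 0 < k) (hr : 1 < r) (x : ℝ) :
    HasDerivAt (fun y => cutCos k y ^ r)
      (-(r * k * cutCos k x ^ (r - 1) * Real.sin (k * x))) x := by
  have hlin : HasDerivAt (fun y => k * y) k x := by
    simpa using (hasDerivAt_id x).const_mul k
  rcases lt_trichotomy |x| (Real.pi / (2 * k)) with h | h | h
  · have hev : (fun y => cutCos k y ^ r) =ᶠ[nhds x] fun y => Real.cos (k * y) ^ r := by
      filter_upwards [continuous_abs.continuousAt.eventually_lt_const h] with y hy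
      simp [cutCos, hy.le]
    have hx : cutCos k x = Real.cos (k * x) := by simp [cutCos, h.le]
    rw [hx]
    refine HasDerivAt.congr_of_eventuallyEq ?_ hev
    refine (hlin.cos.rpow_const (p := r) (Or.inr hr.le)).congr_deriv ?_
    ring
  · have hcos : Real.cos (k * x) = 0 := by
      rw [← Real.cos_abs, abs_mul, abs_of_pos hk, h,
        show k * (Real.pi / (2 * k)) = Real.pi / 2 by field_simp, Real.cos_pi_div_two]
    have hx : cutCos k x = 0 := by simp [cutCos, hcos]
    have hO : cutCos k =O[nhds x] fun y => y - x := by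
      have h1 : (fun y => Real.cos (k * y)) =O[nhds x] fun y => y - x := by
        simpa [hcos] using hlin.cos.isBigO_sub
      exact (Asymptotics.IsBigO.of_bound' (Filter.Eventually.of_forall fun y => by
        simpa using abs_cutCos_le k y)).trans h1
    have ho : (fun y => cutCos k y ^ (r - 1)) =o[nhds x] fun _ => (1 : ℝ) := by
      rw [Asymptotics.isLittleO_one_iff]
      have := ((continuous_cutCos hk).rpow_const
        (p := r - 1) fun _ => Or.inr (by linarith)).tendsto x
      rwa [hx, Real.zero_rpow (by linarith)] at this
    rw [hx, Real.zero_rpow (by linarith), hasDerivAt_iff_isLittleO]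
    refine (hO.mul_isLittleO ho).congr (fun y => ?_) fun y => mul_one _
    rw [hx, Real.zero_rpow (by linarith)]
    have := Real.rpow_add_of_nonneg (cutCos_nonneg hk y) zero_le_one
      (show 0 ≤ r - 1 by linarith)
    rw [add_sub_cancel, Real.rpow_one] at this
    simp [this]
  · have hev : (fun y => cutCos k y ^ r) =ᶠ[nhds x] fun _ => 0 := by
      filter_upwards [continuous_abs.continuousAt.eventually_const_lt h] with y hy
      simp [cutCos, hy.not_ge, Real.zero_rpow (by linarith : r ≠ 0)]
    have hx : cutCos k x = 0 := by simp [cutCos, h.not_ge]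
    rw [hx, Real.zero_rpow (by linarith)]
    simpa using (hasDerivAt_const x (0 : ℝ)).congr_of_eventuallyEq hev

lemma hasDerivAt_cutCos_rpow_mul_sin {k r : ℝ} (hk : 0 < k) (hr : 2 < r) (x : ℝ) :
    HasDerivAt (fun y => -(r * k * cutCos k y ^ (r - 1) * Real.sin (k * y)))
      (r * k ^ 2 * ((r - 1) * cutCos k x ^ (r - 2) - r * cutCos k x ^ r)) x := by
  have hlin : HasDerivAt (fun y => k * y) k x := by
    simpa using (hasDerivAt_id x).const_mul k
  have hd := (((hasDerivAt_cutCos_rpow hk (by linarith : 1 < r - 1) x).const_mul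
    (r * k)).mul hlin.sin).neg
  refine hd.congr_deriv ?_
  have h0 := cutCos_nonneg hk x
  have h1 : cutCos k x ^ (r - 1) = cutCos k x ^ (r - 2) * cutCos k x := by
    have := Real.rpow_add_of_nonneg h0 (show 0 ≤ r - 2 by linarith) zero_le_one
    rwa [Real.rpow_one, show r - 2 + 1 = r - 1 by ring] at this
  have h2 : cutCos k x ^ r = cutCos k x ^ (r - 2) * cutCos k x ^ 2 := by
    have := Real.rpow_add_of_nonneg h0 (show 0 ≤ r - 2 by linarith) zero_le_two
    rwa [Real.rpow_two, sub_add_cancel] at this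
  have hc := cutCos_mul_cos k x
  have hc2 : cutCos k x ^ (r - 2) * Real.cos (k * x) ^ 2
      = cutCos k x ^ (r - 2) * cutCos k x ^ 2 := by
    unfold cutCos
    split_ifs
    · rfl
    · simp [Real.zero_rpow (by linarith : r - 2 ≠ 0)]
  have hs := Real.sin_sq (k * x)
  rw [show r - 1 - 1 = r - 2 by ring, h1, h2]
  linear_combination (r * k ^ 2 * (r - 1) * cutCos k x ^ (r - 2)) * hs
    - r * k ^ 2 * (r - 1) * hc2 - r * k ^ 2 * cutCos k x ^ (r - 2) * hc

lemma two_lt_two_div_one_sub {p : ℝ} (hp0 : 0 < p) (hp1 : p < 1) : 2 < 2 / (1 - p) := by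
  rw [lt_div_iff₀ (by linarith)]
  linarith

lemma uhat_eq_cutCos_rpow {p : ℝ} (a lam : ℝ) (hp1 : p < 1) (x : ℝ) :
    uhat a p lam x = uH a p lam * cutCos ((1 - p) * Real.sqrt lam / 2) x ^ (2 / (1 - p)) := by
  have hm : 2 / (1 - p) ≠ 0 := div_ne_zero two_ne_zero (by linarith)
  unfold uhat cutCos TH
  rw [show 2 * ((1 - p) * Real.sqrt lam / 2) = (1 - p) * Real.sqrt lam by ring,
    show (1 - p) * Real.sqrt lam / 2 * x = (1 - p) * Real.sqrt lam * x / 2 by ring]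
  split_ifs
  · rfl
  · rw [Real.zero_rpow hm, mul_zero]

lemma uH_eq_mul_rpow {a p lam : ℝ} (ha : 0 < a) (hp0 : 0 < p) (hp1 : p < 1) (hlam : 0 < lam) :
    uH a p lam * (lam * (p + 1) / 2) = a * uH a p lam ^ p := by
  have hU := uH_pos (p := p) ha hp0 hlam
  have h1 : uH a p lam ^ (1 - p) = 2 * a / ((p + 1) * lam) := by
    unfold uH
    rw [← Real.rpow_mul (by positivity), one_div_mul_cancel (by linarith), Real.rpow_one]
  have h2 : uH a p lam = uH a p lam ^ (1 - p) * uH a p lam ^ p := by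
    rw [← Real.rpow_add hU, sub_add_cancel, Real.rpow_one]
  rw [h1] at h2
  calc uH a p lam * (lam * (p + 1) / 2)
      = 2 * a / ((p + 1) * lam) * uH a p lam ^ p * (lam * (p + 1) / 2) := by rw [← h2]
    _ = a * uH a p lam ^ p := by field_simp

lemma contDiff_two_of_hasDerivAt_s3 {u v w : ℝ → ℝ} (hu : ∀ x, HasDerivAt u (v x) x)
    (hv : ∀ x, HasDerivAt v (w x) x) (hw : Continuous w) : ContDiff ℝ 2 u := by
  rw [show (2 : WithTop ℕ∞) = 1 + 1 by norm_num, contDiff_succ_iff_deriv]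
  refine ⟨fun x => (hu x).differentiableAt, by simp, ?_⟩
  rw [show deriv u = v from funext fun x => (hu x).deriv, contDiff_one_iff_deriv,
    show deriv v = w from funext fun x => (hv x).deriv]
  exact ⟨fun x => (hv x).differentiableAt, hw⟩

lemma solvesCauchy_zero (a lam : ℝ) {p : ℝ} (hp0 : 0 < p) :
    SolvesCauchy a p lam (fun _ => 0) := by
  refine ⟨contDiff_const, fun _ => le_rfl, rfl, by simp, fun x => ?_⟩
  simp [Real.zero_rpow hp0.ne']

lemma solvesCauchy_uhat_shift {a p lam : ℝ} (ha : 0 < a) (hp0 : 0 < p) (hp1 : p < 1)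
    (hlam : 0 < lam) : SolvesCauchy a p lam (fun x => uhat a p lam (x - TH p lam)) := by
  have hq : 0 < 1 - p := by linarith
  have hs : 0 < Real.sqrt lam := Real.sqrt_pos.2 hlam
  have hsq : Real.sqrt lam ^ 2 = lam := Real.sq_sqrt hlam.le
  have hr := two_lt_two_div_one_sub hp0 hp1
  have hk : 0 < (1 - p) * Real.sqrt lam / 2 := by positivity
  have hU := uH_pos (p := p) ha hp0 hlam
  have hrk : 2 / (1 - p) * ((1 - p) * Real.sqrt lam / 2) ^ 2 = lam * (1 - p) / 2 := by
    field_simp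
    rw [hsq]
  have hkT : (1 - p) * Real.sqrt lam / 2 * (0 - TH p lam) = -(Real.pi / 2) := by
    unfold TH
    field_simp
    ring
  have hrp : 2 / (1 - p) * p = 2 / (1 - p) - 2 := by
    field_simp
    ring
  have hrq : 2 / (1 - p) * (1 - p) = 2 := by field_simp
  simp only [uhat_eq_cutCos_rpow a lam hp1]
  set r := 2 / (1 - p)
  set k := (1 - p) * Real.sqrt lam / 2
  set T := TH p lam
  have hzero : cutCos k (0 - T) = 0 := by
    simp only [cutCos, hkT, Real.cos_neg, Real.cos_pi_div_two, ite_self]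
  have hu : ∀ x, HasDerivAt (fun y => uH a p lam * cutCos k (y - T) ^ r)
      (uH a p lam * -(r * k * cutCos k (x - T) ^ (r - 1) * Real.sin (k * (x - T)))) x :=
    fun x => ((hasDerivAt_cutCos_rpow hk (by linarith) (x - T)).comp_sub_const x T).const_mul _
  have hv := fun x =>
    ((hasDerivAt_cutCos_rpow_mul_sin hk hr (x - T)).comp_sub_const x T).const_mul (uH a p lam)
  have hcont : Continuous fun x => cutCos k (x - T) := (continuous_cutCos hk).comp (by fun_prop)
  refine ⟨contDiff_two_of_hasDerivAt_s3 hu hv ?_, fun x => ?_, ?_, ?_, fun x => ?_⟩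
  · have h1 := hcont.rpow_const (p := r) fun _ => Or.inr (by linarith)
    have h2 := hcont.rpow_const (p := r - 2) fun _ => Or.inr (by linarith)
    fun_prop
  · exact mul_nonneg hU.le (Real.rpow_nonneg (cutCos_nonneg hk _) _)
  · beta_reduce
    rw [hzero, Real.zero_rpow (by linarith), mul_zero]
  · rw [(hu 0).deriv, hzero, Real.zero_rpow (by linarith)]
    simp
  · have hc := cutCos_nonneg hk (x - T)
    rw [funext fun y => (hu y).deriv, (hv x).deriv,
      Real.mul_rpow hU.le (Real.rpow_nonneg hc _), ← Real.rpow_mul hc, hrp, hrk]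
    have hUp := uH_eq_mul_rpow ha hp0 hp1 hlam
    linear_combination cutCos k (x - T) ^ (r - 2) * hUp
      + uH a p lam * lam / 2 * (cutCos k (x - T) ^ (r - 2) - cutCos k (x - T) ^ r) * hrq

lemma uhat_shift_ne_zero {a p lam : ℝ} (ha : 0 < a) (hp0 : 0 < p) (hp1 : p < 1)
    (hlam : 0 < lam) : (fun x => uhat a p lam (x - TH p lam)) ≠ (fun _ : ℝ => (0 : ℝ)) := by
  intro h
  have hT : 0 ≤ TH p lam := by
    have : 0 < 1 - p := by linarith
    unfold TH
    positivity
  have := congrFun h (TH p lam)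
  simp [uhat, hT, (uH_pos (p := p) ha hp0 hlam).ne'] at this

theorem stmt3 (a p lam : ℝ) (ha : 0 < a) (hp0 : 0 < p) (hp1 : p < 1) (hlam : 0 < lam) :
    SolvesCauchy a p lam (fun _ => 0) ∧
    SolvesCauchy a p lam (fun x => uhat a p lam (x - TH p lam)) ∧
    (fun x => uhat a p lam (x - TH p lam)) ≠ (fun _ : ℝ => (0 : ℝ)) ∧
    ∃ u : ℝ → ℝ, u ≠ (fun _ => 0) ∧ SolvesCauchy a p lam u :=
  ⟨solvesCauchy_zero a lam hp0, solvesCauchy_uhat_shift ha hp0 hp1 hlam,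
    uhat_shift_ne_zero ha hp0 hp1 hlam, _, uhat_shift_ne_zero ha hp0 hp1 hlam,
    solvesCauchy_uhat_shift ha hp0 hp1 hlam⟩
end

section
/- Let 0 ≤ α < β ≤ L and let u be a C² function on [α,β] with u(α) = u(β) = 0, u(x) > 0 for all x ∈ (α,β), and u''(x) + λ·u(x) − a·u(x)^p = 0 on [α,β]. Then the maximum of u on [α,β] is attained at the midpoint (α+β)/2 and satisfies u((α+β)/2) ≥ (2a/((p+1)·λ))^{1/(1−p)}. -/
open Set in
/-- An autonomous second-order equation with Lipschitz right-hand side is reversible: a solution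
with zero slope at `x₀` is symmetric about `x₀`. -/
theorem reflection_eq_of_lipschitzOnWith {g u v : ℝ → ℝ} {S : Set ℝ} {K : NNReal} {x₀ r : ℝ}
    (hg : LipschitzOnWith K g S) (hr : 0 < r)
    (hu : ∀ x ∈ Ioo (x₀ - r) (x₀ + r), HasDerivAt u (v x) x)
    (hv : ∀ x ∈ Ioo (x₀ - r) (x₀ + r), HasDerivAt v (g (u x)) x)
    (hS : ∀ x ∈ Ioo (x₀ - r) (x₀ + r), u x ∈ S) (hv₀ : v x₀ = 0) {t : ℝ}
    (ht : t ∈ Ioo (-r) r) : u (x₀ - t) = u (x₀ + t) := by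
  have hlip : LipschitzOnWith (max 1 K) (fun z : ℝ × ℝ => (z.2, g z.1)) (S ×ˢ univ) := by
    refine LipschitzOnWith.prodMk LipschitzWith.prod_snd.lipschitzOnWith ?_
    simpa [Function.comp_def] using hg.comp LipschitzWith.prod_fst.lipschitzOnWith (fun z hz => hz.1)
  have hplus : ∀ s ∈ Ioo (-r) r, x₀ + s ∈ Ioo (x₀ - r) (x₀ + r) := fun s hs =>
    ⟨by linarith [hs.1], by linarith [hs.2]⟩
  have hminus : ∀ s ∈ Ioo (-r) r, x₀ - s ∈ Ioo (x₀ - r) (x₀ + r) := fun s hs =>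
    ⟨by linarith [hs.2], by linarith [hs.1]⟩
  have huniq := ODE_solution_unique_of_mem_Ioo (v := fun _ z => (z.2, g z.1))
    (s := fun _ => S ×ˢ univ) (K := max 1 K) (t₀ := 0) (a := -r) (b := r)
    (f := fun s => (u (x₀ - s), -v (x₀ - s))) (g := fun s => (u (x₀ + s), v (x₀ + s)))
    (fun _ _ => hlip) ⟨by linarith, hr⟩ ?_ ?_ (by simp [hv₀])
  · exact congrArg Prod.fst (huniq ht)
  · intro s hs
    have hx := hminus s hs
    refine ⟨(((hu _ hx).comp_const_sub x₀ s).prodMk ?_), hS _ hx, mem_univ _⟩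
    simpa [Pi.neg_def] using ((hv _ hx).comp_const_sub x₀ s).neg
  · intro s hs
    have hx := hplus s hs
    exact ⟨((hu _ hx).comp_const_add x₀ s).prodMk ((hv _ hx).comp_const_add x₀ s),
      hS _ hx, mem_univ _⟩

open Set in
theorem lipschitzOnWith_const_mul_rpow_sub {a p lam m : ℝ} (ha : 0 < a) (hp0 : 0 < p) (hp1 : p < 1)
    (hlam : 0 < lam) (hm : 0 < m) :
    LipschitzOnWith (Real.toNNReal (a * (p * m ^ (p - 1)) + lam))
      (fun y : ℝ => a * y ^ p - lam * y) (Ici m) := by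
  refine (convex_Ici m).lipschitzOnWith_of_nnnorm_hasDerivWithin_le
    (f' := fun y => a * (p * y ^ (p - 1)) - lam * 1) (fun y hy => ?_) (fun y hy => ?_)
  · have hy0 : 0 < y := hm.trans_le hy
    exact (((Real.hasDerivAt_rpow_const (Or.inl hy0.ne')).const_mul a).sub
      ((hasDerivAt_id y).const_mul lam)).hasDerivWithinAt
  · have hy0 : 0 < y := hm.trans_le hy
    rw [← NNReal.coe_le_coe, coe_nnnorm, Real.coe_toNNReal _ (by positivity), Real.norm_eq_abs]
    have hpow : y ^ (p - 1) ≤ m ^ (p - 1) :=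
      Real.rpow_le_rpow_of_nonpos hm hy (by linarith)
    have hle : a * (p * y ^ (p - 1)) ≤ a * (p * m ^ (p - 1)) := by gcongr
    have hnn : 0 ≤ a * (p * y ^ (p - 1)) := by positivity
    rw [abs_le]
    constructor <;> linarith

open Set in
/-- A positive solution of `u'' = a u ^ p - λ u` is symmetric about each of its critical points. -/
theorem reflection_eq_of_pos {a p lam α β x₀ r : ℝ} {u v : ℝ → ℝ} (ha : 0 < a) (hp0 : 0 < p)
    (hp1 : p < 1) (hlam : 0 < lam) (hr : 0 < r) (hα : α ≤ x₀ - r) (hβ : x₀ + r ≤ β)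
    (hcont : ContinuousOn u (Icc α β)) (hpos : ∀ x ∈ Ioo α β, 0 < u x)
    (hu : ∀ x ∈ Ioo α β, HasDerivAt u (v x) x)
    (hv : ∀ x ∈ Ioo α β, HasDerivAt v (a * u x ^ p - lam * u x) x) (hv₀ : v x₀ = 0) :
    u (x₀ - r) = u (x₀ + r) := by
  have hopen : EqOn (fun t => u (x₀ - t)) (fun t => u (x₀ + t)) (Ioo 0 r) := by
    intro t ht
    obtain ⟨q, htq, hqr⟩ := exists_between ht.2
    have hq : 0 < q := ht.1.trans htq
    have hsub : Icc (x₀ - q) (x₀ + q) ⊆ Ioo α β := fun x hx =>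
      ⟨by linarith [hx.1], by linarith [hx.2]⟩
    obtain ⟨z, hz, hmin⟩ := isCompact_Icc.exists_isMinOn
      (nonempty_Icc.2 (by linarith : x₀ - q ≤ x₀ + q))
      (hcont.mono (hsub.trans Ioo_subset_Icc_self))
    have hsub' := Ioo_subset_Icc_self.trans hsub
    exact reflection_eq_of_lipschitzOnWith
      (lipschitzOnWith_const_mul_rpow_sub ha hp0 hp1 hlam (hpos z (hsub hz))) hq
      (fun x hx => hu x (hsub' hx)) (fun x hx => hv x (hsub' hx))
      (fun x hx => hmin (Ioo_subset_Icc_self hx)) hv₀ ⟨by linarith [ht.1], htq⟩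
  refine hopen.of_subset_closure (t := Icc 0 r) ?_ ?_ Ioo_subset_Icc_self
    (closure_Ioo hr.ne).ge (right_mem_Icc.2 hr.le)
  · exact hcont.comp (by fun_prop) fun t ht => ⟨by linarith [ht.2], by linarith [ht.1]⟩
  · exact hcont.comp (by fun_prop) fun t ht => ⟨by linarith [ht.1], by linarith [ht.2]⟩

open Set in
/-- The energy `u' ^ 2 / 2 + λ u ^ 2 / 2 - a u ^ (p + 1) / (p + 1)` takes equal values at the
endpoints of an interval on which `u'' = a u ^ p - λ u`. -/
theorem energy_eq {a p lam α x₀ : ℝ} {u v : ℝ → ℝ} (hp0 : 0 < p) (hx₀ : α < x₀)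
    (hcu : ContinuousOn u (Icc α x₀)) (hcv : ContinuousOn v (Icc α x₀))
    (hu : ∀ x ∈ Ioo α x₀, HasDerivAt u (v x) x)
    (hv : ∀ x ∈ Ioo α x₀, HasDerivAt v (a * u x ^ p - lam * u x) x) :
    v x₀ ^ 2 / 2 + lam * u x₀ ^ 2 / 2 - a * u x₀ ^ (p + 1) / (p + 1) =
      v α ^ 2 / 2 + lam * u α ^ 2 / 2 - a * u α ^ (p + 1) / (p + 1) := by
  obtain ⟨c, -, hc⟩ := exists_hasDerivAt_eq_slope
    (fun x => v x ^ 2 / 2 + lam * u x ^ 2 / 2 - a * u x ^ (p + 1) / (p + 1)) (fun _ => 0) hx₀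
    (by
      have hpow : ContinuousOn (fun x => u x ^ (p + 1)) (Icc α x₀) :=
        hcu.rpow_const fun x _ => Or.inr (by linarith)
      fun_prop)
    (fun x hx => by
      have hpow := (hu x hx).rpow_const (p := p + 1) (Or.inr (by linarith))
      have hder := ((((hv x hx).pow 2).div_const 2).add
        ((((hu x hx).pow 2).const_mul lam).div_const 2)).sub
        ((hpow.const_mul a).div_const (p + 1))
      refine hder.congr_deriv ?_
      have hne : p + 1 ≠ 0 := by linarith
      rw [add_sub_cancel_right]
      field_simp
      ring)
  have hne : x₀ - α ≠ 0 := by linarith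
  rw [eq_div_iff hne, zero_mul] at hc
  linarith

theorem rpow_le_of_energy_nonneg {a p lam s : ℝ} (ha : 0 < a) (hp0 : 0 < p) (hp1 : p < 1)
    (hlam : 0 < lam) (hs : 0 < s) (h : 0 ≤ lam * s ^ 2 / 2 - a * s ^ (p + 1) / (p + 1)) :
    (2 * a / ((p + 1) * lam)) ^ (1 / (1 - p)) ≤ s := by
  have hfac : s ^ 2 = s ^ (1 - p) * s ^ (p + 1) := by
    rw [← Real.rpow_add hs, ← Real.rpow_natCast]
    congr 1
    push_cast
    ring
  have hpos : 0 < s ^ (p + 1) := Real.rpow_pos_of_pos hs _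
  rw [one_div, Real.rpow_inv_le_iff_of_pos (by positivity) hs.le (by linarith),
    div_le_iff₀ (by positivity)]
  have hp : 0 < p + 1 := by linarith
  have heq : lam * s ^ 2 / 2 - a * s ^ (p + 1) / (p + 1) =
      s ^ (p + 1) * (s ^ (1 - p) * ((p + 1) * lam) - 2 * a) / (2 * (p + 1)) := by
    rw [hfac]
    field_simp
  rw [heq] at h
  by_contra! hlt
  exact absurd h (not_le.2 (div_neg_of_neg_of_pos
    (mul_neg_of_pos_of_neg hpos (by linarith)) (by positivity)))

theorem stmt6 (a L p lam : ℝ) (ha : 0 < a) (hL : 0 < L) (hp0 : 0 < p) (hp1 : p < 1)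
    (hlam : 0 < lam) (α β : ℝ) (hα : 0 ≤ α) (hαβ : α < β) (hβ : β ≤ L)
    (u : ℝ → ℝ)
    (hu : ContDiffOn ℝ 2 u (Set.Icc α β))
    (huα : u α = 0) (huβ : u β = 0)
    (hupos : ∀ x ∈ Set.Ioo α β, 0 < u x)
    (hode : ∀ x ∈ Set.Icc α β,
      iteratedDerivWithin 2 u (Set.Icc α β) x + lam * u x - a * u x ^ p = 0) :
    (∀ x ∈ Set.Icc α β, u x ≤ u ((α + β) / 2)) ∧
    (2 * a / ((p + 1) * lam)) ^ (1 / (1 - p)) ≤ u ((α + β) / 2) := by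
  set v := derivWithin u (Set.Icc α β)
  have hcu : ContinuousOn u (Set.Icc α β) := hu.continuousOn
  have hdv : ContDiffOn ℝ 1 v (Set.Icc α β) :=
    hu.derivWithin (uniqueDiffOn_Icc hαβ) (by norm_num)
  have hderu : ∀ x ∈ Set.Ioo α β, HasDerivAt u (v x) x := fun x hx =>
    ((hu.differentiableOn (by norm_num)) x (Set.Ioo_subset_Icc_self hx)).hasDerivWithinAt.hasDerivAt
      (Icc_mem_nhds hx.1 hx.2)
  have hderv : ∀ x ∈ Set.Ioo α β, HasDerivAt v (a * u x ^ p - lam * u x) x := fun x hx => by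
    have hx' := Set.Ioo_subset_Icc_self hx
    have hder := ((hdv.differentiableOn (by norm_num)) x hx').hasDerivWithinAt.hasDerivAt
      (Icc_mem_nhds hx.1 hx.2)
    refine hder.congr_deriv ?_
    have hsecond : iteratedDerivWithin 2 u (Set.Icc α β) x =
        derivWithin v (Set.Icc α β) x := by
      rw [iteratedDerivWithin_succ, iteratedDerivWithin_one]
    linarith [hode x hx']
  have hmid : (α + β) / 2 ∈ Set.Ioo α β := ⟨by linarith, by linarith⟩
  obtain ⟨x₀, hx₀, hmax⟩ := isCompact_Icc.exists_isMaxOn (Set.nonempty_Icc.2 hαβ.le) hcu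
  have hpos : 0 < u x₀ := (hupos _ hmid).trans_le (hmax (Set.Ioo_subset_Icc_self hmid))
  have hαx : α < x₀ := hx₀.1.lt_of_ne fun h => by rw [← h, huα] at hpos; exact hpos.false
  have hxβ : x₀ < β := hx₀.2.lt_of_ne fun h => by rw [h, huβ] at hpos; exact hpos.false
  have hv₀ : v x₀ = 0 :=
    (hmax.isLocalMax (Icc_mem_nhds hαx hxβ)).hasDerivAt_eq_zero (hderu x₀ ⟨hαx, hxβ⟩)
  have hx₀mid : x₀ = (α + β) / 2 := by
    rcases lt_trichotomy (x₀ - α) (β - x₀) with h | h | h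
    · have hsymm := reflection_eq_of_pos ha hp0 hp1 hlam (sub_pos.2 hαx) (by linarith)
        (by linarith) hcu hupos hderu hderv hv₀
      rw [sub_sub_cancel, huα] at hsymm
      exact absurd hsymm (hupos _ ⟨by linarith, by linarith⟩).ne
    · linarith
    · have hsymm := reflection_eq_of_pos ha hp0 hp1 hlam (sub_pos.2 hxβ) (by linarith)
        (by linarith) hcu hupos hderu hderv hv₀
      rw [add_sub_cancel, huβ] at hsymm
      exact absurd hsymm (hupos _ ⟨by linarith, by linarith⟩).ne'
  rw [← hx₀mid]
  refine ⟨fun x hx => hmax hx, rpow_le_of_energy_nonneg ha hp0 hp1 hlam hpos ?_⟩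
  have hsub : Set.Icc α x₀ ⊆ Set.Icc α β := Set.Icc_subset_Icc_right hxβ.le
  have hsub' : Set.Ioo α x₀ ⊆ Set.Ioo α β := Set.Ioo_subset_Ioo_right hxβ.le
  have henergy := energy_eq (a := a) (lam := lam) hp0 hαx (hcu.mono hsub)
    (hdv.continuousOn.mono hsub) (fun x hx => hderu x (hsub' hx)) (fun x hx => hderv x (hsub' hx))
  rw [hv₀, huα, Real.zero_rpow (by linarith)] at henergy
  have hsq := sq_nonneg (v α)
  simp only [ne_eq, OfNat.ofNat_ne_zero, not_false_eq_true, zero_pow, mul_zero, zero_div,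
    sub_zero, zero_add, add_zero] at henergy
  linarith
end

section
/- If (π/L)² < λ < (2/(1−p))²·(π/L)², then the BVP has a classical positive solution. -/
/-- A nonnegative solution of the boundary value problem
`u'' + λu - a u^p = 0` in `[0,L]`, `u(0) = u(L) = 0`. -/
def IsNonnegSolution (a L p lam : ℝ) (u : ℝ → ℝ) : Prop :=
  ContDiffOn ℝ 2 u (Set.Icc 0 L) ∧
  (∀ x ∈ Set.Icc (0 : ℝ) L, 0 ≤ u x) ∧
  u 0 = 0 ∧ u L = 0 ∧
  ∀ x ∈ Set.Icc (0 : ℝ) L,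
    iteratedDerivWithin 2 u (Set.Icc 0 L) x + lam * u x - a * u x ^ p = 0

/-- A classical positive solution: positive in `(0,L)`, `u'(0) > 0` and `u'(L) < 0`. -/
def IsClassicalPositiveSolution (a L p lam : ℝ) (u : ℝ → ℝ) : Prop :=
  IsNonnegSolution a L p lam u ∧
  (∀ x ∈ Set.Ioo (0 : ℝ) L, 0 < u x) ∧
  0 < derivWithin u (Set.Icc 0 L) 0 ∧
  derivWithin u (Set.Icc 0 L) L < 0

open Real Set Filter Topology

/-- A product `c * W` with `c` vanishing at `x` is differentiable at `x` as soon as `c` is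
differentiable and `W` is merely continuous there. -/
lemma hasDerivAt_mul_of_eq_zero {c W : ℝ → ℝ} {c' x : ℝ} (hc : HasDerivAt c c' x)
    (h0 : c x = 0) (hW : ContinuousAt W x) :
    HasDerivAt (fun y => c y * W y) (c' * W x) x := by
  rw [hasDerivAt_iff_tendsto_slope] at hc ⊢
  refine (hc.mul (hW.tendsto.mono_left nhdsWithin_le_nhds)).congr fun y => ?_
  simp only [slope_def_field, h0]
  ring

/-- A continuous function with nonzero value and differentiable square is differentiable. -/
lemma hasDerivAt_of_hasDerivAt_sq {V : ℝ → ℝ} {Q' x : ℝ} (hV : ContinuousAt V x)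
    (h0 : V x ≠ 0) (hQ : HasDerivAt (fun y => V y ^ 2) Q' x) :
    HasDerivAt V (Q' / (2 * V x)) x := by
  rw [hasDerivAt_iff_tendsto_slope] at hQ ⊢
  have hsum : Tendsto (fun y => V y + V x) (𝓝[≠] x) (𝓝 (2 * V x)) := by
    rw [two_mul]
    exact (hV.tendsto.add_const _).mono_left nhdsWithin_le_nhds
  have hne : (2 * V x) ≠ 0 := mul_ne_zero two_ne_zero h0
  refine (hQ.div hsum hne).congr' ?_
  filter_upwards [hsum.eventually_ne hne] with y hy
  simp only [slope_def_field, Pi.div_apply]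
  rw [div_div, mul_comm (y - x), ← div_div]
  congr 1
  rw [div_eq_iff hy]
  ring

/-- A function with derivative bounded below by a positive constant has a global differentiable
inverse. -/
lemma exists_inverse_of_le_deriv {t g : ℝ → ℝ} {c : ℝ} (hc : 0 < c)
    (ht : ∀ x, HasDerivAt t (g x) x) (hg : ∀ x, c ≤ g x) :
    ∃ φ : ℝ → ℝ, StrictMono φ ∧ (∀ x, φ (t x) = x) ∧ ∀ x, HasDerivAt φ (g (φ x))⁻¹ x := by
  have hmono : StrictMono t := strictMono_of_hasDerivAt_pos ht fun x => hc.trans_le (hg x)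
  have hcont : Continuous t := continuous_iff_continuousAt.2 fun x => (ht x).continuousAt
  have hlin : Monotone fun x => t x - c * x := by
    have hd : ∀ x, HasDerivAt (fun x => t x - c * x) (g x - c * 1) x := fun x =>
      (ht x).sub ((hasDerivAt_id x).const_mul c)
    refine monotone_of_deriv_nonneg (fun x => (hd x).differentiableAt) fun x => ?_
    rw [(hd x).deriv]
    linarith [hg x]
  have htop : Tendsto t atTop atTop := by
    refine tendsto_atTop_mono' _ ?_
      (tendsto_atTop_add_const_right _ (t 0) (tendsto_id.const_mul_atTop hc))
    filter_upwards [eventually_ge_atTop 0] with x hx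
    have := hlin hx
    simp only [id] at this ⊢
    linarith
  have hbot : Tendsto t atBot atBot := by
    refine tendsto_atBot_mono' _ ?_
      (tendsto_atBot_add_const_right _ (t 0) (tendsto_id.const_mul_atBot hc))
    filter_upwards [eventually_le_atBot 0] with x hx
    have := hlin hx
    simp only [id] at this ⊢
    linarith
  let e := hmono.orderIsoOfSurjective t (hcont.surjective htop hbot)
  have hright : ∀ x, t (e.symm x) = x := e.apply_symm_apply
  refine ⟨e.symm, e.symm.strictMono, e.symm_apply_apply, fun x => ?_⟩
  exact HasDerivAt.of_local_left_inverse e.symm.continuous.continuousAt (ht _)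
    (hc.trans_le (hg _)).ne' (Eventually.of_forall hright)

/-- The continuous extension of `(1 - |sin φ| ^ (p + 1)) / cos φ ^ 2`. -/
noncomputable def angularWeight (p φ : ℝ) : ℝ :=
  dslope (fun y : ℝ => y ^ ((p + 1) / 2)) 1 (sin φ ^ 2)

/-- The density `dx / dφ` of the time map in the variable `φ` with `u = M sin φ`. -/
noncomputable def timeDensity (p lam μ φ : ℝ) : ℝ :=
  (√(lam - μ * angularWeight p φ))⁻¹

lemma cos_sq_mul_angularWeight (p φ : ℝ) :
    cos φ ^ 2 * angularWeight p φ = 1 - |sin φ| ^ (p + 1) := by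
  have h := sub_smul_dslope (fun y : ℝ => y ^ ((p + 1) / 2)) 1 (sin φ ^ 2)
  have hpow : (sin φ ^ 2) ^ ((p + 1) / 2) = |sin φ| ^ (p + 1) := by
    rw [← sq_abs, ← rpow_natCast, ← rpow_mul (abs_nonneg _)]
    congr 1
    push_cast
    ring
  simp only [smul_eq_mul, one_rpow, hpow] at h
  rw [angularWeight, cos_sq']
  linarith

lemma angularWeight_of_cos_eq_zero {p φ : ℝ} (h : cos φ = 0) :
    angularWeight p φ = (p + 1) / 2 := by
  have hs : sin φ ^ 2 = 1 := by rw [sin_sq, h]; norm_num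
  rw [angularWeight, hs, dslope_same, (hasDerivAt_rpow_const (Or.inl one_ne_zero)).deriv]
  simp

lemma continuous_angularWeight {p : ℝ} (hp : 0 < p) : Continuous (angularWeight p) := by
  have hcont : Continuous (dslope (fun y : ℝ => y ^ ((p + 1) / 2)) 1) := by
    refine continuous_iff_continuousAt.2 fun y => ?_
    rcases eq_or_ne y 1 with rfl | hy
    · exact continuousAt_dslope_same.2
        (hasDerivAt_rpow_const (Or.inl one_ne_zero)).differentiableAt
    · exact (continuousAt_dslope_of_ne hy).2 (continuousAt_rpow_const _ _ (Or.inr (by linarith)))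
  exact hcont.comp (continuous_sin.pow 2)

lemma angularWeight_nonneg {p : ℝ} (hp : 0 < p) (φ : ℝ) : 0 ≤ angularWeight p φ := by
  by_cases h : cos φ = 0
  · rw [angularWeight_of_cos_eq_zero h]
    positivity
  · have h1 := cos_sq_mul_angularWeight p φ
    have h2 : |sin φ| ^ (p + 1) ≤ 1 :=
      rpow_le_one (abs_nonneg _) (abs_sin_le_one φ) (by linarith)
    have h3 : 0 < cos φ ^ 2 := by positivity
    exact nonneg_of_mul_nonneg_right (by linarith) h3

lemma sq_le_rpow_of_le_one {p s : ℝ} (hp0 : 0 < p) (hp1 : p < 1) (hs0 : 0 ≤ s) (hs1 : s ≤ 1) :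
    s ^ 2 ≤ s ^ (p + 1) := by
  rw [← rpow_natCast]
  exact rpow_le_rpow_of_exponent_ge' hs0 hs1 (by linarith) (by push_cast; linarith)

lemma angularWeight_le_one {p : ℝ} (hp0 : 0 < p) (hp1 : p < 1) (φ : ℝ) :
    angularWeight p φ ≤ 1 := by
  by_cases h : cos φ = 0
  · rw [angularWeight_of_cos_eq_zero h]
    linarith
  · have h1 := cos_sq_mul_angularWeight p φ
    have h2 := sq_le_rpow_of_le_one hp0 hp1 (abs_nonneg (sin φ)) (abs_sin_le_one φ)
    have h3 : 0 < cos φ ^ 2 := by positivity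
    have h4 := sin_sq_add_cos_sq φ
    rw [sq_abs] at h2
    exact le_of_mul_le_mul_left (by linarith) h3

lemma sub_mul_angularWeight_pos {p lam μ : ℝ} (hp0 : 0 < p) (hp1 : p < 1) (hμ0 : 0 ≤ μ)
    (hμ : μ < lam) (φ : ℝ) : 0 < lam - μ * angularWeight p φ := by
  have := mul_le_mul_of_nonneg_left (angularWeight_le_one hp0 hp1 φ) hμ0
  linarith

lemma continuous_timeDensity {p lam μ : ℝ} (hp0 : 0 < p) (hp1 : p < 1) (hμ0 : 0 ≤ μ)
    (hμ : μ < lam) : Continuous (timeDensity p lam μ) := by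
  have := continuous_angularWeight hp0
  refine Continuous.inv₀ (by fun_prop) fun φ => ?_
  exact (sqrt_pos.2 (sub_mul_angularWeight_pos hp0 hp1 hμ0 hμ φ)).ne'

lemma inv_sqrt_le_timeDensity {p lam μ : ℝ} (hp0 : 0 < p) (hp1 : p < 1) (hμ0 : 0 ≤ μ)
    (hμ : μ < lam) (φ : ℝ) : (√lam)⁻¹ ≤ timeDensity p lam μ φ := by
  refine inv_anti₀ (sqrt_pos.2 (sub_mul_angularWeight_pos hp0 hp1 hμ0 hμ φ)) (sqrt_le_sqrt ?_)
  have := mul_nonneg hμ0 (angularWeight_nonneg hp0 φ)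
  linarith

lemma timeDensity_pi_sub (p lam μ φ : ℝ) :
    timeDensity p lam μ (π - φ) = timeDensity p lam μ φ := by
  simp [timeDensity, angularWeight, sin_pi_sub]

lemma integral_timeDensity_pi {p lam μ : ℝ} (hp0 : 0 < p) (hp1 : p < 1) (hμ0 : 0 ≤ μ)
    (hμ : μ < lam) :
    ∫ φ in (0 : ℝ)..π, timeDensity p lam μ φ =
      2 * ∫ φ in (0 : ℝ)..(π / 2), timeDensity p lam μ φ := by
  have hc := continuous_timeDensity hp0 hp1 hμ0 hμ
  have hsym := intervalIntegral.integral_comp_sub_left (a := 0) (b := π / 2)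
    (timeDensity p lam μ) π
  simp only [timeDensity_pi_sub, sub_zero, sub_half] at hsym
  rw [← intervalIntegral.integral_add_adjacent_intervals (hc.intervalIntegrable 0 (π / 2))
    (hc.intervalIntegrable (π / 2) π), ← hsym]
  ring

/-- With `K = √(1 + ε)` and `μ = lam (1 - ε ^ 3)`, the derivative of
`arcsin (sin φ ^ q / K) / (q √lam)`, `q = (1 - p) / 2`, is at most the time density. -/
lemma arcsin_deriv_le_timeDensity {p lam ε φ : ℝ} (hp0 : 0 < p) (hp1 : p < 1) (hlam : 0 < lam)
    (hε0 : 0 < ε) (hε1 : ε < 1) (hs : ε < sin φ) (hcos : 0 < cos φ) :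
    1 / √(1 - (sin φ ^ ((1 - p) / 2) / √(1 + ε)) ^ 2) *
        (cos φ * ((1 - p) / 2) * sin φ ^ ((1 - p) / 2 - 1) / √(1 + ε)) /
      ((1 - p) / 2 * √lam) ≤ timeDensity p lam (lam * (1 - ε ^ 3)) φ := by
  set s := sin φ with hsdef
  set c := cos φ with hcdef
  set q := (1 - p) / 2 with hq
  set P := s ^ (q - 1) with hP
  set μ := lam * (1 - ε ^ 3) with hμdef
  have hq0 : 0 < q := by rw [hq]; linarith
  have hs0 : 0 < s := hε0.trans hs
  have hs1 : s ≤ 1 := sin_le_one φ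
  have hsc : c ^ 2 = 1 - s ^ 2 := cos_sq' φ
  have hP0 : 0 < P := rpow_pos_of_pos hs0 _
  have hsq : s ^ q = s * P := by
    rw [hP, rpow_sub_one hs0.ne']
    field_simp
  have hsP : s ^ (p + 1) * P ^ 2 = 1 := by
    rw [hP, ← rpow_natCast, ← rpow_mul hs0.le, ← rpow_add hs0, hq]
    convert rpow_zero s using 2
    push_cast
    ring
  have hsq1 : s ^ q ≤ 1 := rpow_le_one hs0.le hs1 hq0.le
  rw [hsq] at hsq1 ⊢
  have hsq0 : 0 < s * P := by positivity
  have hK : √(1 + ε) ^ 2 = 1 + ε := sq_sqrt (by linarith)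
  have hK0 : 0 < √(1 + ε) := sqrt_pos.2 (by linarith)
  have hε3 : ε ^ 3 < 1 := pow_lt_one₀ hε0.le hε1 (by norm_num)
  have hμ0 : 0 ≤ μ := mul_nonneg hlam.le (by linarith)
  have hμ : μ < lam := by
    have : 0 < ε ^ 3 := by positivity
    rw [hμdef]
    nlinarith
  have hA := sub_mul_angularWeight_pos hp0 hp1 hμ0 hμ φ
  have hw := cos_sq_mul_angularWeight p φ
  rw [← hsdef, ← hcdef, abs_of_pos hs0] at hw
  set w := angularWeight p φ
  have hd : 0 < 1 + ε - (s * P) ^ 2 := by nlinarith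
  have hεP : ε ^ 2 * P ^ 2 ≤ 1 := by
    rw [← hsP]
    refine mul_le_mul_of_nonneg_right ?_ (sq_nonneg P)
    exact (pow_le_pow_left₀ hε0.le hs.le 2).trans (sq_le_rpow_of_le_one hp0 hp1 hs0.le hs1)
  have hkey : P ^ 2 * (c ^ 2 * (lam - μ * w)) ≤ lam * (1 + ε - (s * P) ^ 2) := by
    have h1 : c ^ 2 * (lam - μ * w) = lam * (1 - s ^ 2) - μ * (1 - s ^ (p + 1)) := by
      rw [← hw, ← hsc]
      ring
    have h2 : P ^ 2 * (c ^ 2 * (lam - μ * w)) =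
        lam * (ε * (ε ^ 2 * P ^ 2)) + μ - lam * (s * P) ^ 2 := by
      rw [h1, hμdef]
      linear_combination lam * (1 - ε ^ 3) * hsP
    have h3 : lam * (ε * (ε ^ 2 * P ^ 2)) ≤ lam * (ε * 1) := by gcongr
    rw [h2]
    linarith
  have hroot : √(1 - (s * P / √(1 + ε)) ^ 2) = √(1 + ε - (s * P) ^ 2) / √(1 + ε) := by
    rw [← sqrt_div hd.le, div_pow, hK]
    congr 1
    field_simp
  have hd' := sqrt_pos.2 hd
  have hl' := sqrt_pos.2 hlam
  have hlhs : 1 / √(1 - (s * P / √(1 + ε)) ^ 2) * (c * q * P / √(1 + ε)) / (q * √lam) =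
      c * P / (√(1 + ε - (s * P) ^ 2) * √lam) := by
    rw [hroot]
    field_simp
  rw [hlhs, timeDensity, ← sqrt_mul hd.le, inv_eq_one_div,
    div_le_div_iff₀ (sqrt_pos.2 (mul_pos hd hlam)) (sqrt_pos.2 hA), one_mul]
  refine le_sqrt_of_sq_le ?_
  rw [mul_pow, sq_sqrt hA.le]
  linarith

lemma exists_lt_integral_timeDensity {p lam B : ℝ} (hp0 : 0 < p) (hp1 : p < 1) (hlam : 0 < lam)
    (hB : B < (π / 2) / ((1 - p) / 2 * √lam)) :
    ∃ μ, 0 ≤ μ ∧ μ < lam ∧ B < ∫ φ in (0 : ℝ)..(π / 2), timeDensity p lam μ φ := by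
  set q := (1 - p) / 2 with hq
  have hq0 : 0 < q := by rw [hq]; linarith
  have hlim : Tendsto (fun ε : ℝ => arcsin (1 ^ q / √(1 + ε)) / (q * √lam) -
      arcsin (ε ^ q / √(1 + ε)) / (q * √lam)) (𝓝[>] 0) (𝓝 ((π / 2) / (q * √lam))) := by
    have hden : √(1 + (0 : ℝ)) ≠ 0 := by simp
    have hK : ContinuousAt (fun ε : ℝ => √(1 + ε)) 0 := by fun_prop
    have h1 : ContinuousAt (fun ε : ℝ => arcsin (1 ^ q / √(1 + ε)) / (q * √lam) -
        arcsin (ε ^ q / √(1 + ε)) / (q * √lam)) 0 :=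
      ((continuous_arcsin.continuousAt.comp (continuousAt_const.div hK hden)).div_const _).sub
        ((continuous_arcsin.continuousAt.comp
          ((continuousAt_rpow_const _ _ (Or.inr hq0.le)).div hK hden)).div_const _)
    have h2 := h1.tendsto.mono_left (nhdsWithin_le_nhds (s := Ioi 0))
    simpa [zero_rpow hq0.ne'] using h2
  obtain ⟨ε, hεB, hε0, hε1⟩ := ((hlim.eventually_const_lt hB).and
    (Ioo_mem_nhdsGT (zero_lt_one' ℝ))).exists
  have hε3 : ε ^ 3 < 1 := pow_lt_one₀ hε0.le hε1 (by norm_num)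
  have hμ0 : 0 ≤ lam * (1 - ε ^ 3) := mul_nonneg hlam.le (by linarith)
  have hμ : lam * (1 - ε ^ 3) < lam := by
    have : 0 < ε ^ 3 := by positivity
    nlinarith
  refine ⟨lam * (1 - ε ^ 3), hμ0, hμ, hεB.trans_le ?_⟩
  have hc := continuous_timeDensity hp0 hp1 hμ0 hμ
  have ha0 : 0 < arcsin ε := arcsin_pos.2 hε0
  have ha1 : arcsin ε < π / 2 := arcsin_lt_pi_div_two.2 hε1
  have hsa : sin (arcsin ε) = ε := sin_arcsin (by linarith) hε1.le
  have hsub : ∫ φ in (arcsin ε)..(π / 2), timeDensity p lam (lam * (1 - ε ^ 3)) φ ≤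
      ∫ φ in (0 : ℝ)..(π / 2), timeDensity p lam (lam * (1 - ε ^ 3)) φ := by
    refine intervalIntegral.integral_mono_interval ha0.le ha1.le le_rfl
      (Eventually.of_forall fun φ => ?_) (hc.intervalIntegrable _ _)
    exact (inv_nonneg.2 (sqrt_nonneg _))
  refine le_trans ?_ hsub
  have hcont : Continuous fun φ : ℝ => arcsin (sin φ ^ q / √(1 + ε)) / (q * √lam) := by
    have h := continuous_sin.rpow_const (p := q) fun _ => Or.inr hq0.le
    exact (continuous_arcsin.comp (h.div_const _)).div_const _
  have hmain := intervalIntegral.sub_le_integral_of_hasDeriv_right_of_le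
    (g := fun φ => arcsin (sin φ ^ q / √(1 + ε)) / (q * √lam))
    (g' := fun φ => 1 / √(1 - (sin φ ^ q / √(1 + ε)) ^ 2) *
        (cos φ * q * sin φ ^ (q - 1) / √(1 + ε)) / (q * √lam))
    (φ := timeDensity p lam (lam * (1 - ε ^ 3))) ha1.le hcont.continuousOn ?_
    (hc.continuousOn.integrableOn_compact isCompact_Icc) ?_
  · simpa only [hsa, sin_pi_div_two] using hmain
  · intro φ hφ
    have hs0 : 0 < sin φ := sin_pos_of_pos_of_lt_pi (ha0.trans hφ.1) (by linarith [hφ.2, pi_pos])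
    have hK : 1 < √(1 + ε) := by
      rw [lt_sqrt zero_le_one]
      linarith
    have hle : sin φ ^ q / √(1 + ε) < 1 := by
      rw [div_lt_one (by linarith)]
      exact (rpow_le_one hs0.le (sin_le_one φ) hq0.le).trans_lt hK
    have hge : 0 < sin φ ^ q / √(1 + ε) := div_pos (rpow_pos_of_pos hs0 _) (by linarith)
    have h1 := ((hasDerivAt_sin φ).rpow_const (p := q) (Or.inl hs0.ne')).div_const (√(1 + ε))
    exact (((hasDerivAt_arcsin (by linarith) hle.ne).comp φ h1).div_const _).hasDerivWithinAt
  · intro φ hφ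
    refine arcsin_deriv_le_timeDensity hp0 hp1 hlam hε0 hε1 ?_
      (cos_pos_of_mem_Ioo ⟨by linarith [hφ.1], hφ.2⟩)
    rw [← hsa]
    exact sin_lt_sin_of_lt_of_le_pi_div_two (by linarith) hφ.2.le hφ.1

/-- The time map takes the value `L` for some parameter `0 < μ < lam`. -/
lemma exists_integral_timeDensity_eq {L p lam : ℝ} (hL : 0 < L) (hp0 : 0 < p) (hp1 : p < 1)
    (hlow : (π / L) ^ 2 < lam) (hhigh : lam < (2 / (1 - p)) ^ 2 * (π / L) ^ 2) :
    ∃ μ, 0 < μ ∧ μ < lam ∧ ∫ φ in (0 : ℝ)..π, timeDensity p lam μ φ = L := by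
  have hlam : 0 < lam := (sq_nonneg _).trans_lt hlow
  have hl := sqrt_pos.2 hlam
  have hp : 0 < 1 - p := by linarith
  have hlow' : π / √lam < L := by
    have h := lt_sqrt_of_sq_lt hlow
    rw [div_lt_iff₀ hL] at h
    rw [div_lt_iff₀ hl]
    linarith
  have hhigh' : L / 2 < (π / 2) / ((1 - p) / 2 * √lam) := by
    rw [← mul_pow] at hhigh
    have h := (sqrt_lt' (by positivity)).2 hhigh
    rw [div_mul_div_comm, lt_div_iff₀ (by positivity)] at h
    rw [lt_div_iff₀ (by positivity)]
    linarith
  obtain ⟨ν, hν0, hν, hνL⟩ := exists_lt_integral_timeDensity hp0 hp1 hlam hhigh'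
  have hcont : Continuous fun μ : ℝ =>
      ∫ φ in (0 : ℝ)..π, timeDensity p lam (max 0 (min μ ν)) φ := by
    refine intervalIntegral.continuous_parametric_intervalIntegral_of_continuous' ?_ 0 π
    have := continuous_angularWeight hp0
    refine Continuous.inv₀ (by fun_prop) fun x => ?_
    exact (sqrt_pos.2 (sub_mul_angularWeight_pos hp0 hp1 (le_max_left _ _)
      (max_lt hlam ((min_le_right _ _).trans_lt hν)) _)).ne'
  have hzero : ∫ φ in (0 : ℝ)..π, timeDensity p lam 0 φ = π / √lam := by
    simp [timeDensity, div_eq_mul_inv]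
  obtain ⟨μ, hμ, hμL⟩ := intermediate_value_Icc hν0 hcont.continuousOn
    (show L ∈ Icc _ _ by
      simp only [min_self, min_eq_left hν0, max_self, max_eq_right hν0, hzero,
        integral_timeDensity_pi hp0 hp1 hν0 hν]
      constructor <;> linarith)
  simp only [min_eq_left hμ.2, max_eq_right hμ.1] at hμL
  refine ⟨μ, hμ.1.lt_of_ne ?_, hμ.2.trans_lt hν, hμL⟩
  rintro rfl
  linarith

/-- The velocity `cos φ / timeDensity φ` of `sin φ` along the flow is differentiable, although
`angularWeight` itself need not be differentiable where `cos φ = 0`. -/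
lemma hasDerivAt_cos_mul_sqrt {p lam μ : ℝ} (hp0 : 0 < p) (hp1 : p < 1) (hμ0 : 0 ≤ μ)
    (hμ : μ < lam) (φ : ℝ) :
    HasDerivAt (fun φ => cos φ * √(lam - μ * angularWeight p φ))
      ((-lam * sin φ + μ * ((p + 1) / 2) * (|sin φ| ^ (p - 1) * sin φ)) /
        √(lam - μ * angularWeight p φ)) φ := by
  have hA := fun φ => sub_mul_angularWeight_pos hp0 hp1 hμ0 hμ φ
  have hw := continuous_angularWeight hp0
  have hWc : Continuous fun φ => √(lam - μ * angularWeight p φ) := by fun_prop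
  have hW := sqrt_pos.2 (hA φ)
  have hW2 := sq_sqrt (hA φ).le
  by_cases hcos : cos φ = 0
  · refine (hasDerivAt_mul_of_eq_zero (hasDerivAt_cos φ) hcos hWc.continuousAt).congr_deriv ?_
    have habs : |sin φ| = 1 := by
      rw [← sq_eq_sq₀ (abs_nonneg _) zero_le_one, sq_abs, sin_sq, hcos]
      norm_num
    rw [eq_div_iff hW.ne', habs, one_rpow, mul_assoc, ← sq, hW2,
      angularWeight_of_cos_eq_zero hcos]
    ring
  · have hQ : HasDerivAt (fun φ => (cos φ * √(lam - μ * angularWeight p φ)) ^ 2)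
        (lam * (2 * cos φ * -sin φ) +
          μ * ((p + 1) * |sin φ| ^ (p - 1) * sin φ * cos φ)) φ := by
      have heq : (fun φ => (cos φ * √(lam - μ * angularWeight p φ)) ^ 2) =
          fun φ => lam * cos φ ^ 2 + μ * (|sin φ| ^ (p + 1) - 1) := by
        funext ψ
        rw [mul_pow, sq_sqrt (hA ψ).le]
        linear_combination -μ * cos_sq_mul_angularWeight p ψ
      rw [heq]
      have h1 := ((hasDerivAt_cos φ).pow 2).const_mul lam
      have h2 := ((((hasDerivAt_abs_rpow (sin φ) (p := p + 1) (by linarith)).comp φ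
        (hasDerivAt_sin φ))).sub_const 1).const_mul μ
      rw [show p + 1 - 2 = p - 1 by ring] at h2
      refine (h1.add h2).congr_deriv ?_
      norm_num
    have hne : cos φ * √(lam - μ * angularWeight p φ) ≠ 0 := mul_ne_zero hcos hW.ne'
    have hcont : Continuous fun φ => cos φ * √(lam - μ * angularWeight p φ) :=
      continuous_cos.mul hWc
    refine (hasDerivAt_of_hasDerivAt_sq hcont.continuousAt hne hQ).congr_deriv ?_
    field_simp

/-- A function with two successive derivatives realizing the equation is a solution. -/
lemma isNonnegSolution_of_hasDerivAt {a L p lam : ℝ} {u v w : ℝ → ℝ} (hL : 0 < L) (hp : 0 < p)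
    (hu : ∀ x, HasDerivAt u (v x) x) (hv : ∀ x, HasDerivAt v (w x) x)
    (hw : ∀ x ∈ Icc (0 : ℝ) L, w x = a * u x ^ p - lam * u x)
    (hnonneg : ∀ x ∈ Icc (0 : ℝ) L, 0 ≤ u x) (h0 : u 0 = 0) (h1 : u L = 0) :
    IsNonnegSolution a L p lam u := by
  have hU := uniqueDiffOn_Icc hL
  have hdu : ∀ x ∈ Icc (0 : ℝ) L, derivWithin u (Icc 0 L) x = v x := fun x hx =>
    (hu x).hasDerivWithinAt.derivWithin (hU x hx)
  have hdv : ∀ x ∈ Icc (0 : ℝ) L, derivWithin v (Icc 0 L) x = w x := fun x hx =>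
    (hv x).hasDerivWithinAt.derivWithin (hU x hx)
  have hcu : Continuous u := continuous_iff_continuousAt.2 fun x => (hu x).continuousAt
  have hcw : ContinuousOn w (Icc 0 L) := by
    have h := hcu.rpow_const (p := p) fun _ => Or.inr hp.le
    exact ContinuousOn.congr (by fun_prop) hw
  have hCv : ContDiffOn ℝ 1 v (Icc 0 L) := by
    rw [← zero_add (1 : WithTop ℕ∞), contDiffOn_succ_iff_derivWithin hU]
    refine ⟨fun x _ => (hv x).differentiableAt.differentiableWithinAt, by simp, ?_⟩
    exact contDiffOn_zero.2 (hcw.congr hdv)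
  refine ⟨?_, hnonneg, h0, h1, fun x hx => ?_⟩
  · rw [← one_add_one_eq_two, contDiffOn_succ_iff_derivWithin hU]
    exact ⟨fun x _ => (hu x).differentiableAt.differentiableWithinAt, by simp, hCv.congr hdu⟩
  · rw [iteratedDerivWithin_succ, iteratedDerivWithin_one, derivWithin_congr hdu (hdu x hx),
      hdv x hx, hw x hx]
    ring

theorem stmt7 (a L p lam : ℝ) (ha : 0 < a) (hL : 0 < L) (hp0 : 0 < p) (hp1 : p < 1)
    (hlow : (Real.pi / L) ^ 2 < lam)
    (hhigh : lam < (2 / (1 - p)) ^ 2 * (Real.pi / L) ^ 2) :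
    ∃ u : ℝ → ℝ, IsClassicalPositiveSolution a L p lam u := by
  obtain ⟨μ, hμ0, hμ, hT⟩ := exists_integral_timeDensity_eq hL hp0 hp1 hlow hhigh
  have hA := fun φ => sub_mul_angularWeight_pos hp0 hp1 hμ0.le hμ φ
  obtain ⟨φ, hmono, hinv, hφ⟩ := exists_inverse_of_le_deriv
    (inv_pos.2 (sqrt_pos.2 (hμ0.trans hμ)))
    (fun x => ((continuous_timeDensity hp0 hp1 hμ0.le hμ).integral_hasStrictDerivAt 0 x).hasDerivAt)
    (inv_sqrt_le_timeDensity hp0 hp1 hμ0.le hμ)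
  simp only [timeDensity, inv_inv] at hφ
  have hφ0 : φ 0 = 0 := by simpa using hinv 0
  have hφL : φ L = π := by simpa only [hT] using hinv π
  set M : ℝ := (a / (μ * ((p + 1) / 2))) ^ (1 - p)⁻¹ with hM
  have hM0 : 0 < M := by positivity
  have hMp : μ * ((p + 1) / 2) * M = a * M ^ p := by
    have h1 : M ^ (1 - p) = a / (μ * ((p + 1) / 2)) := by
      rw [hM, rpow_inv_rpow (by positivity) (by linarith)]
    rw [rpow_sub hM0, rpow_one, div_eq_div_iff (by positivity) (by positivity)] at h1
    linarith
  have hu : ∀ x, HasDerivAt (fun x => M * sin (φ x))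
      (M * (cos (φ x) * √(lam - μ * angularWeight p (φ x)))) x := fun x =>
    ((hasDerivAt_sin (φ x)).comp x (hφ x)).const_mul M
  have hv : ∀ x, HasDerivAt (fun x => M * (cos (φ x) * √(lam - μ * angularWeight p (φ x))))
      (M * (-lam * sin (φ x) + μ * ((p + 1) / 2) * (|sin (φ x)| ^ (p - 1) * sin (φ x)))) x := by
    intro x
    refine (((hasDerivAt_cos_mul_sqrt hp0 hp1 hμ0.le hμ (φ x)).comp x (hφ x)).const_mul
      M).congr_deriv ?_
    rw [div_mul_cancel₀ _ (sqrt_pos.2 (hA (φ x))).ne']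
  have hmem : ∀ x ∈ Icc (0 : ℝ) L, φ x ∈ Icc 0 π := fun x hx =>
    ⟨hφ0 ▸ hmono.monotone hx.1, hφL ▸ hmono.monotone hx.2⟩
  have hnonneg : ∀ x ∈ Icc (0 : ℝ) L, 0 ≤ sin (φ x) := fun x hx =>
    sin_nonneg_of_mem_Icc (hmem x hx)
  have hU := uniqueDiffOn_Icc hL
  refine ⟨fun x => M * sin (φ x), isNonnegSolution_of_hasDerivAt hL hp0 hu hv ?_
    (fun x hx => mul_nonneg hM0.le (hnonneg x hx)) (by simp [hφ0]) (by simp [hφL]), ?_, ?_, ?_⟩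
  · intro x hx
    have hs := hnonneg x hx
    have hpow : |sin (φ x)| ^ (p - 1) * sin (φ x) = sin (φ x) ^ p := by
      rw [abs_of_nonneg hs]
      rcases hs.eq_or_lt with h | h
      · rw [← h, zero_rpow hp0.ne', mul_zero]
      · rw [rpow_sub_one h.ne', div_mul_cancel₀ _ h.ne']
    rw [hpow, mul_rpow hM0.le hs]
    linear_combination sin (φ x) ^ p * hMp
  · exact fun x hx => mul_pos hM0 (sin_pos_of_pos_of_lt_pi (hφ0 ▸ hmono hx.1) (hφL ▸ hmono hx.2))
  · rw [(hu 0).hasDerivWithinAt.derivWithin (hU 0 (left_mem_Icc.2 hL.le)), hφ0, cos_zero, one_mul]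
    exact mul_pos hM0 (sqrt_pos.2 (hA 0))
  · rw [(hu L).hasDerivWithinAt.derivWithin (hU L (right_mem_Icc.2 hL.le)), hφL, cos_pi]
    have := mul_pos hM0 (sqrt_pos.2 (hA π))
    linarith
end

section
/- If the BVP has a classical positive solution u, then (π/L)² < λ < (2/(1−p))²·(π/L)². Moreover, in that case the classical positive solution is unique, is symmetric about L/2 (u(L−x) = u(x) for all x ∈ [0,L]), attains its maximum exactly at x = L/2, and its maximum value exceeds u_H(λ) = (2a/((p+1)λ))^{1/(1−p)}. -/
open Set

/-- A function which starts nonpositive and crosses zero only downwards is negative inside. -/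
lemma neg_of_deriv_neg_at_zeros {f f' : ℝ → ℝ} {a b : ℝ}
    (hf : ∀ x ∈ Icc a b, HasDerivWithinAt f (f' x) (Icc a b) x) (ha : f a ≤ 0)
    (h : ∀ x ∈ Ico a b, f x = 0 → f' x < 0) : ∀ x ∈ Ioo a b, f x < 0 := by
  have hle : ∀ ⦃x⦄, x ∈ Icc a b → f x ≤ 0 :=
    image_le_of_deriv_right_lt_deriv_boundary' (f' := f') (B := fun _ => 0) (B' := fun _ => 0)
      (fun x hx => (hf x hx).continuousWithinAt)
      (fun x hx => (hf x (Ico_subset_Icc_self hx)).mono_of_mem_nhdsWithin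
        (Icc_mem_nhdsGE_of_mem hx))
      ha continuousOn_const (fun x _ => hasDerivWithinAt_const x _ 0) h
  intro x hx
  refine lt_of_le_of_ne (hle (Ioo_subset_Icc_self hx)) fun h0 => ?_
  have hmax : IsLocalMax f x := by
    filter_upwards [Icc_mem_nhds hx.1 hx.2] with y hy
    rw [h0]
    exact hle hy
  exact (h x (Ioo_subset_Ico_self hx) h0).ne (hmax.hasDerivAt_eq_zero
    ((hf x (Ioo_subset_Icc_self hx)).hasDerivAt (Icc_mem_nhds hx.1 hx.2)))

lemma mul_rpow_lt_mul_rpow {p x y : ℝ} (hp : p < 1) (hx : 0 < x) (hxy : x < y) :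
    x * y ^ p < y * x ^ p := by
  have hy := hx.trans hxy
  have h := Real.rpow_lt_rpow hx.le hxy (sub_pos.2 hp)
  rw [Real.rpow_sub hx, Real.rpow_sub hy, Real.rpow_one, Real.rpow_one,
    div_lt_div_iff₀ (Real.rpow_pos_of_pos hx p) (Real.rpow_pos_of_pos hy p)] at h
  exact h

lemma abs_rpow_add_one_sub_le {q R s t : ℝ} (hq : 0 < q) (hs : s ∈ Icc 0 R) (ht : t ∈ Icc 0 R) :
    |s ^ q * s - t ^ q * t| ≤ (q + 1) * R ^ q * |s - t| := by
  rw [← Real.rpow_add_one' hs.1 (by linarith), ← Real.rpow_add_one' ht.1 (by linarith)]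
  refine Convex.norm_image_sub_le_of_norm_hasDerivWithin_le (s := Icc 0 R)
    (f := fun y : ℝ => y ^ (q + 1)) (f' := fun y => (q + 1) * y ^ q) (fun y hy => ?_)
    (fun y hy => ?_) (convex_Icc _ _) ht hs
  · have := (Real.hasDerivAt_rpow_const (x := y) (p := q + 1) (Or.inr (by linarith)))
    rw [add_sub_cancel_right] at this
    exact this.hasDerivWithinAt
  · have := Real.rpow_nonneg hy.1 q
    rw [Real.norm_of_nonneg (by positivity)]
    have := Real.rpow_le_rpow hy.1 hy.2 hq.le
    gcongr

/-- First-order form of the boundary value problem: `u` is a classical positive solution with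
derivative `du`. -/
structure IsPosSol (a L p lam : ℝ) (u du : ℝ → ℝ) : Prop where
  deriv : ∀ x ∈ Icc 0 L, HasDerivWithinAt u (du x) (Icc 0 L) x
  deriv_deriv : ∀ x ∈ Icc 0 L, HasDerivWithinAt du (a * u x ^ p - lam * u x) (Icc 0 L) x
  left : u 0 = 0
  right : u L = 0
  pos : ∀ x ∈ Ioo 0 L, 0 < u x
  deriv_left : 0 < du 0
  deriv_right : du L < 0

/-- `du` is positive before `m`, vanishes at `m` and is negative after `m`. -/
structure IsPeak (L : ℝ) (du : ℝ → ℝ) (m : ℝ) : Prop where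
  mem : m ∈ Ioo 0 L
  zero : du m = 0
  pos : ∀ x ∈ Ico 0 m, 0 < du x
  neg : ∀ x ∈ Ioc m L, du x < 0

lemma IsPeak.reflect {L m : ℝ} {du : ℝ → ℝ} (hm : IsPeak L du m) :
    IsPeak L (fun x => -du (L - x)) (L - m) := by
  refine ⟨⟨by linarith [hm.mem.2], by linarith [hm.mem.1]⟩, by simp [hm.zero], fun x hx => ?_,
    fun x hx => ?_⟩
  · linarith [hm.neg (L - x) ⟨by linarith [hx.2], by linarith [hx.1]⟩]
  · linarith [hm.pos (L - x) ⟨by linarith [hx.2], by linarith [hx.1]⟩]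

lemma IsClassicalPositiveSolution.isPosSol {a L p lam : ℝ} {u : ℝ → ℝ} (hL : 0 < L)
    (h : IsClassicalPositiveSolution a L p lam u) :
    IsPosSol a L p lam u (derivWithin u (Icc 0 L)) := by
  obtain ⟨⟨hC, -, h0, hL0, hode⟩, hpos, hd0, hdL⟩ := h
  refine ⟨fun x hx => (hC.differentiableOn (by norm_num) x hx).hasDerivWithinAt, fun x hx => ?_,
    h0, hL0, hpos, hd0, hdL⟩
  have h1 : ContDiffOn ℝ 1 (derivWithin u (Icc 0 L)) (Icc 0 L) :=
    hC.derivWithin (uniqueDiffOn_Icc hL) (by norm_num)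
  have h2 := (h1.differentiableOn (by norm_num) x hx).hasDerivWithinAt
  have h3 := hode x hx
  rw [iteratedDerivWithin_succ, iteratedDerivWithin_one] at h3
  convert! h2 using 1
  linarith

namespace IsPosSol

variable {a L p lam : ℝ} {u du v dv : ℝ → ℝ} {m x : ℝ}

lemma nonneg (h : IsPosSol a L p lam u du) (hx : x ∈ Icc 0 L) : 0 ≤ u x := by
  rcases eq_or_lt_of_le hx.1 with h0 | h0
  · rw [← h0, h.left]
  rcases eq_or_lt_of_le hx.2 with h1 | h1
  · rw [h1, h.right]
  exact (h.pos x ⟨h0, h1⟩).le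

lemma hasDerivAt (h : IsPosSol a L p lam u du) (hx : x ∈ Ioo 0 L) : HasDerivAt u (du x) x :=
  (h.deriv x (Ioo_subset_Icc_self hx)).hasDerivAt (Icc_mem_nhds hx.1 hx.2)

lemma hasDerivAt_deriv (h : IsPosSol a L p lam u du) (hx : x ∈ Ioo 0 L) :
    HasDerivAt du (a * u x ^ p - lam * u x) x :=
  (h.deriv_deriv x (Ioo_subset_Icc_self hx)).hasDerivAt (Icc_mem_nhds hx.1 hx.2)

lemma continuousOn (h : IsPosSol a L p lam u du) : ContinuousOn u (Icc 0 L) :=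
  fun x hx => (h.deriv x hx).continuousWithinAt

lemma continuousOn_deriv (h : IsPosSol a L p lam u du) : ContinuousOn du (Icc 0 L) :=
  fun x hx => (h.deriv_deriv x hx).continuousWithinAt

lemma energy (h : IsPosSol a L p lam u du) (hp : 0 < p) (hx : x ∈ Icc 0 L) :
    du x ^ 2 = du 0 ^ 2 - lam * u x ^ 2 + 2 * a / (p + 1) * (u x ^ p * u x) := by
  have hd : ∀ y ∈ Icc 0 L, HasDerivWithinAt
      (fun y => du y ^ 2 + lam * u y ^ 2 - 2 * a / (p + 1) * u y ^ (p + 1)) 0 (Icc 0 L) y := by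
    intro y hy
    convert! (((h.deriv_deriv y hy).pow 2).add (((h.deriv y hy).pow 2).const_mul lam)).sub
      (((h.deriv y hy).rpow_const (p := p + 1) (Or.inr (by linarith))).const_mul
        (2 * a / (p + 1))) using 1
    have : p + 1 ≠ 0 := by linarith
    rw [add_sub_cancel_right]
    field_simp
    ring
  have hc := constant_of_has_deriv_right_zero (fun y hy => (hd y hy).continuousWithinAt)
    (fun y hy => (hd y (Ico_subset_Icc_self hy)).mono_of_mem_nhdsWithin
      (Icc_mem_nhdsGE_of_mem hy)) x hx
  simp only [h.left] at hc
  rw [Real.zero_rpow (by linarith), Real.rpow_add_one' (h.nonneg hx) (by linarith)] at hc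
  linarith

/-- Energy inequality at critical points. -/
lemma lt_of_deriv_eq_zero (h : IsPosSol a L p lam u du) (hp : 0 < p) (hx : x ∈ Icc 0 L)
    (hx0 : du x = 0) : 0 < u x ∧ 2 * a / (p + 1) * u x ^ p < lam * u x := by
  have hpos : 0 < u x := by
    refine h.pos x ⟨lt_of_le_of_ne hx.1 fun h0 => ?_, lt_of_le_of_ne hx.2 fun h0 => ?_⟩
    · subst h0
      exact h.deriv_left.ne' hx0
    · subst h0
      exact h.deriv_right.ne hx0
  refine ⟨hpos, ?_⟩
  have he := h.energy hp hx
  rw [hx0] at he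
  have := pow_pos h.deriv_left 2
  refine lt_of_mul_lt_mul_right ?_ hpos.le
  linarith

lemma deriv_deriv_neg (h : IsPosSol a L p lam u du) (ha : 0 < a) (hp : 0 < p) (hp1 : p < 1)
    (hx : x ∈ Icc 0 L) (hx0 : du x = 0) : a * u x ^ p - lam * u x < 0 := by
  obtain ⟨hpos, hlt⟩ := h.lt_of_deriv_eq_zero hp hx hx0
  have : a ≤ 2 * a / (p + 1) := by
    rw [le_div_iff₀ (by linarith)]
    nlinarith
  have := mul_le_mul_of_nonneg_right this (Real.rpow_pos_of_pos hpos p).le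
  linarith

lemma exists_peak (h : IsPosSol a L p lam u du) (ha : 0 < a) (hL : 0 < L) (hp : 0 < p)
    (hp1 : p < 1) : ∃ m, IsPeak L du m := by
  obtain ⟨m, hm, hm0⟩ := exists_hasDerivAt_eq_zero hL h.continuousOn
    (h.left.trans h.right.symm) (fun x hx => h.hasDerivAt hx)
  have key : ∀ c ∈ Icc 0 L, du c ≤ 0 → ∀ x ∈ Ioo c L, du x < 0 := fun c hc hc0 =>
    neg_of_deriv_neg_at_zeros
      (fun y hy => (h.deriv_deriv y ⟨hc.1.trans hy.1, hy.2⟩).mono (Icc_subset_Icc_left hc.1)) hc0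
      (fun y hy hy0 => h.deriv_deriv_neg ha hp hp1 ⟨hc.1.trans hy.1, hy.2.le⟩ hy0)
  refine ⟨m, hm, hm0, fun x hx => ?_, fun x hx => ?_⟩
  · by_contra! hle
    exact (key x ⟨hx.1, hx.2.le.trans hm.2.le⟩ hle m ⟨hx.2, hm.2⟩).ne hm0
  · rcases eq_or_lt_of_le hx.2 with hxL | hxL
    · rw [hxL]
      exact h.deriv_right
    · exact key m (Ioo_subset_Icc_self hm) hm0.le x ⟨hx.1, hxL⟩

lemma strictMonoOn (h : IsPosSol a L p lam u du) (hm : IsPeak L du m) :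
    StrictMonoOn u (Icc 0 m) := by
  refine strictMonoOn_of_hasDerivWithinAt_pos (f' := du) (convex_Icc _ _)
    (h.continuousOn.mono (Icc_subset_Icc_right hm.mem.2.le)) (fun x hx => ?_) (fun x hx => ?_)
  · rw [interior_Icc] at hx
    exact (h.hasDerivAt ⟨hx.1, hx.2.trans hm.mem.2⟩).hasDerivWithinAt
  · rw [interior_Icc] at hx
    exact hm.pos x (Ioo_subset_Ico_self hx)

lemma strictAntiOn (h : IsPosSol a L p lam u du) (hm : IsPeak L du m) :
    StrictAntiOn u (Icc m L) := by
  refine strictAntiOn_of_hasDerivWithinAt_neg (f' := du) (convex_Icc _ _)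
    (h.continuousOn.mono (Icc_subset_Icc_left hm.mem.1.le)) (fun x hx => ?_) (fun x hx => ?_)
  · rw [interior_Icc] at hx
    exact (h.hasDerivAt ⟨hm.mem.1.trans hx.1, hx.2⟩).hasDerivWithinAt
  · rw [interior_Icc] at hx
    exact hm.neg x (Ioo_subset_Ioc_self hx)

lemma reflect (h : IsPosSol a L p lam u du) :
    IsPosSol a L p lam (fun x => u (L - x)) (fun x => -du (L - x)) := by
  have hmaps : MapsTo (fun x => L - x) (Icc 0 L) (Icc 0 L) := fun x hx =>
    ⟨by linarith [hx.2], by linarith [hx.1]⟩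
  have hsub : ∀ x, HasDerivWithinAt (fun x => L - x) (-1) (Icc 0 L) x := fun x => by
    simpa using (hasDerivWithinAt_id x (Icc 0 L)).const_sub L
  refine ⟨fun x hx => ?_, fun x hx => ?_, by simp [h.right], by simp [h.left],
    fun x hx => h.pos _ ⟨by linarith [hx.2], by linarith [hx.1]⟩, by simpa using h.deriv_right,
    by simpa using h.deriv_left⟩
  · convert! (h.deriv (L - x) (hmaps hx)).comp x (hsub x) hmaps using 1
    ring
  · convert! ((h.deriv_deriv (L - x) (hmaps hx)).comp x (hsub x) hmaps).neg using 1
    ring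

/-- Before their peaks, two solutions with the same initial slope coincide. -/
lemma eqOn_of_deriv_left_eq (hu : IsPosSol a L p lam u du) (hv : IsPosSol a L p lam v dv)
    {m' : ℝ} (ha : 0 < a) (hp : 0 < p) (hlam : 0 < lam) (hm : IsPeak L du m)
    (hm' : IsPeak L dv m') (hle : m ≤ m') (h0 : du 0 = dv 0) : EqOn u v (Icc 0 m) := by
  have hmL := hm.mem.2
  have hico : EqOn u v (Ico 0 m) := by
    intro y hy
    have hsub : Icc 0 y ⊆ Icc 0 L := Icc_subset_Icc_right (hy.2.trans hmL).le
    obtain ⟨z, hz, hzmin⟩ := isCompact_Icc.exists_isMinOn (nonempty_Icc.2 hy.1)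
      (hu.continuousOn_deriv.mono hsub)
    have hδ : 0 < du z := hm.pos z ⟨hz.1, hz.2.trans_lt hy.2⟩
    obtain ⟨A, hA⟩ := isCompact_Icc.exists_bound_of_continuousOn hu.continuousOn
    obtain ⟨B, hB⟩ := isCompact_Icc.exists_bound_of_continuousOn hv.continuousOn
    set R := max A B
    set K := 2 * lam * R + 2 * a / (p + 1) * ((p + 1) * R ^ p)
    have hzero := eq_zero_of_abs_deriv_le_mul_abs_self_of_eq_zero_right (a := 0) (b := y)
      (f := fun x => u x - v x) (f' := fun x => du x - dv x) (K := K / du z)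
      ((hu.continuousOn.sub hv.continuousOn).mono hsub)
      (fun x hx => ((hu.deriv x (hsub (Ico_subset_Icc_self hx))).sub
        (hv.deriv x (hsub (Ico_subset_Icc_self hx)))).mono_of_mem_nhdsWithin
          (Icc_mem_nhdsGE_of_mem ⟨hx.1, hx.2.trans (hy.2.trans hmL)⟩))
      (by simp [hu.left, hv.left]) (fun x hx => ?_) y ⟨hy.1, le_rfl⟩
    · exact sub_eq_zero.1 hzero
    have hxL := hsub (Ico_subset_Icc_self hx)
    have hux : u x ∈ Icc 0 R :=
      ⟨hu.nonneg hxL, ((le_abs_self _).trans (hA x hxL)).trans (le_max_left _ _)⟩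
    have hvx : v x ∈ Icc 0 R :=
      ⟨hv.nonneg hxL, ((le_abs_self _).trans (hB x hxL)).trans (le_max_right _ _)⟩
    have hmin : du z ≤ du x := hzmin (Ico_subset_Icc_self hx)
    have hdv : 0 < dv x := hm'.pos x ⟨hx.1, hx.2.trans (hy.2.trans_le hle)⟩
    have hprod : (du x - dv x) * (du x + dv x) =
        -(lam * (u x + v x) * (u x - v x)) +
          2 * a / (p + 1) * (u x ^ p * u x - v x ^ p * v x) := by
      have e1 := hu.energy hp hxL
      have e2 := hv.energy hp hxL
      rw [h0] at e1
      linear_combination e1 - e2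
    have hc : 0 ≤ 2 * a / (p + 1) := by positivity
    have hbound : |(du x - dv x) * (du x + dv x)| ≤ K * |u x - v x| := by
      rw [hprod]
      refine (abs_add_le _ _).trans ?_
      rw [abs_neg, abs_mul, abs_mul (2 * a / (p + 1)), abs_of_nonneg hc,
        abs_of_nonneg (mul_nonneg hlam.le (add_nonneg hux.1 hvx.1)), add_mul,
        mul_assoc (2 * a / (p + 1))]
      refine add_le_add (mul_le_mul_of_nonneg_right ?_ (abs_nonneg _))
        (mul_le_mul_of_nonneg_left (abs_rpow_add_one_sub_le hp hux hvx) hc)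
      nlinarith [hux.2, hvx.2]
    rw [Real.norm_eq_abs, Real.norm_eq_abs, div_mul_eq_mul_div, le_div_iff₀ hδ]
    refine le_trans ?_ hbound
    rw [abs_mul]
    refine mul_le_mul_of_nonneg_left ?_ (abs_nonneg _)
    rw [abs_of_pos (by linarith)]
    linarith
  exact hico.of_subset_closure (hu.continuousOn.mono (Icc_subset_Icc_right hmL.le))
    (hv.continuousOn.mono (Icc_subset_Icc_right hmL.le)) Ico_subset_Icc_self
    (by rw [closure_Ico hm.mem.1.ne])

lemma deriv_right_eq_neg_deriv_left (h : IsPosSol a L p lam u du) (hL : 0 < L) (hp : 0 < p) :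
    -du L = du 0 := by
  have he := h.energy hp (right_mem_Icc.2 hL.le)
  rw [h.right, mul_zero, zero_pow two_ne_zero, mul_zero, mul_zero, sub_zero, add_zero] at he
  rcases sq_eq_sq_iff_eq_or_eq_neg.1 he with h' | h'
  · linarith [h.deriv_left, h.deriv_right]
  · linarith

lemma peak_eq_half (h : IsPosSol a L p lam u du) (ha : 0 < a) (hL : 0 < L) (hp : 0 < p)
    (hlam : 0 < lam) (hm : IsPeak L du m) : m = L / 2 := by
  have h0 : du 0 = -du (L - 0) := by
    rw [sub_zero, h.deriv_right_eq_neg_deriv_left hL hp]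
  have hm0 := hm.mem.1
  have hmL := hm.mem.2
  rcases le_total m (L - m) with hle | hle
  · have he := h.eqOn_of_deriv_left_eq h.reflect ha hp hlam hm hm.reflect hle h0
      (right_mem_Icc.2 hm0.le)
    have := (h.strictAntiOn hm).injOn ⟨le_rfl, hmL.le⟩ ⟨hle, by linarith⟩ he
    linarith
  · have he := h.reflect.eqOn_of_deriv_left_eq h ha hp hlam hm.reflect hm hle h0.symm
      (right_mem_Icc.2 (by linarith))
    simp only [sub_sub_cancel] at he
    have := (h.strictMonoOn hm).injOn ⟨hm0.le, le_rfl⟩ ⟨by linarith, hle⟩ he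
    linarith

lemma isPeak_half (h : IsPosSol a L p lam u du) (ha : 0 < a) (hL : 0 < L) (hp : 0 < p)
    (hp1 : p < 1) (hlam : 0 < lam) : IsPeak L du (L / 2) := by
  obtain ⟨m, hm⟩ := h.exists_peak ha hL hp hp1
  rwa [h.peak_eq_half ha hL hp hlam hm] at hm

lemma symm (h : IsPosSol a L p lam u du) (ha : 0 < a) (hL : 0 < L) (hp : 0 < p)
    (hp1 : p < 1) (hlam : 0 < lam) (hx : x ∈ Icc 0 L) : u (L - x) = u x := by
  have hm := h.isPeak_half ha hL hp hp1 hlam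
  have he := h.eqOn_of_deriv_left_eq h.reflect ha hp hlam hm hm.reflect (by linarith)
    (by rw [sub_zero, h.deriv_right_eq_neg_deriv_left hL hp])
  rcases le_total x (L / 2) with hle | hle
  · exact (he ⟨hx.1, hle⟩).symm
  · simpa using he (x := L - x) ⟨by linarith [hx.2], by linarith⟩

lemma lt_peak (h : IsPosSol a L p lam u du) (hm : IsPeak L du m) (hx : x ∈ Icc 0 L)
    (hne : x ≠ m) : u x < u m := by
  rcases lt_or_gt_of_ne hne with hlt | hlt
  · exact h.strictMonoOn hm ⟨hx.1, hlt.le⟩ ⟨hm.mem.1.le, le_rfl⟩ hlt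
  · exact h.strictAntiOn hm ⟨le_rfl, hm.mem.2.le⟩ ⟨hlt.le, hx.2⟩ hlt

lemma energy_peak (h : IsPosSol a L p lam u du) (hp : 0 < p) (hm : IsPeak L du m)
    (hx : x ∈ Icc 0 L) :
    du x ^ 2 = lam * (u m ^ 2 - u x ^ 2) - 2 * a / (p + 1) * (u m ^ p * u m - u x ^ p * u x) := by
  have h1 := h.energy hp hx
  have h2 := h.energy hp (Ioo_subset_Icc_self hm.mem)
  rw [hm.zero] at h2
  linear_combination h1 - h2

/-- The time map is strictly decreasing: a solution with a larger maximum reaches it earlier. -/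
lemma not_peak_lt (hu : IsPosSol a L p lam u du) (hv : IsPosSol a L p lam v dv) (ha : 0 < a)
    (hp : 0 < p) (hp1 : p < 1) (hm : IsPeak L du m) (hm' : IsPeak L dv m) : ¬ v m < u m := by
  intro hlt
  have hm0 := hm.mem.1
  have hmL := hm.mem.2
  have hN : 0 < v m := hv.pos m hm.mem
  have hM : 0 < u m := hu.pos m hm.mem
  have hsub : Icc 0 m ⊆ Icc 0 L := Icc_subset_Icc_right hmL.le
  have hcross : ∀ x ∈ Ioo 0 m, v x * u m - u x * v m < 0 := by
    refine neg_of_deriv_neg_at_zeros (f' := fun x => dv x * u m - du x * v m)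
      (fun x hx => (((hv.deriv x (hsub hx)).mono hsub).mul_const (u m)).sub
        (((hu.deriv x (hsub hx)).mono hsub).mul_const (v m)))
      (by simp [hu.left, hv.left]) (fun x hx hx0 => ?_)
    have hxL := hsub (Ico_subset_Icc_self hx)
    have e1 := hu.energy_peak hp hm hxL
    have e2 := hv.energy_peak hp hm' hxL
    obtain ⟨s, hs⟩ : ∃ s, s = u x / u m := ⟨_, rfl⟩
    have hus : u x = s * u m := by rw [hs]; field_simp
    have hvs : v x = s * v m := by
      rw [hs]
      field_simp
      linarith
    have hs0 : 0 ≤ s := hs ▸ div_nonneg (hu.nonneg hxL) hM.le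
    have hs1 : s < 1 := by
      rw [hs, div_lt_one hM]
      exact hu.lt_peak hm hxL hx.2.ne
    rw [hus, Real.mul_rpow hs0 hM.le] at e1
    rw [hvs, Real.mul_rpow hs0 hN.le] at e2
    have hss : s ^ p * s < 1 := by
      have := Real.rpow_le_one hs0 hs1.le hp.le
      nlinarith
    have hdiff : (du x * v m) ^ 2 - (dv x * u m) ^ 2 = 2 * a / (p + 1) * (1 - s ^ p * s) *
        (u m * v m) * (u m * v m ^ p - v m * u m ^ p) := by
      linear_combination v m ^ 2 * e1 - u m ^ 2 * e2
    have hgt := mul_rpow_lt_mul_rpow hp1 hN hlt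
    have hpos : 0 < (du x * v m) ^ 2 - (dv x * u m) ^ 2 := by
      rw [hdiff]
      have : 0 < 1 - s ^ p * s := by linarith
      have : 0 < u m * v m ^ p - v m * u m ^ p := by linarith
      positivity
    have := lt_of_pow_lt_pow_left₀ 2 (mul_pos (hm.pos x hx) hN).le (sub_pos.1 hpos)
    linarith
  have hanti : StrictAntiOn (fun x => du x * v x - u x * dv x) (Icc 0 m) := by
    refine strictAntiOn_of_hasDerivWithinAt_neg
      (f' := fun x => a * (v x * u x ^ p - u x * v x ^ p)) (convex_Icc _ _)
      (((hu.continuousOn_deriv.mul hv.continuousOn).sub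
        (hu.continuousOn.mul hv.continuousOn_deriv)).mono hsub) (fun x hx => ?_) (fun x hx => ?_)
    · rw [interior_Icc] at hx
      have hxL : x ∈ Ioo 0 L := ⟨hx.1, hx.2.trans hmL⟩
      convert! (((hu.hasDerivAt_deriv hxL).mul (hv.hasDerivAt hxL)).sub
        ((hu.hasDerivAt hxL).mul (hv.hasDerivAt_deriv hxL))).hasDerivWithinAt using 1
      ring
    · rw [interior_Icc] at hx
      have hvx : 0 < v x := hv.pos x ⟨hx.1, hx.2.trans hmL⟩
      have hlt' : v x < u x := by
        have := hcross x hx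
        nlinarith
      exact mul_neg_of_pos_of_neg ha (sub_neg.2 (mul_rpow_lt_mul_rpow hp1 hvx hlt'))
  have := hanti ⟨le_rfl, hm0.le⟩ ⟨hm0.le, le_rfl⟩ hm0
  simp [hu.left, hv.left, hm.zero, hm'.zero] at this

lemma eqOn (hu : IsPosSol a L p lam u du) (hv : IsPosSol a L p lam v dv) (ha : 0 < a)
    (hL : 0 < L) (hp : 0 < p) (hp1 : p < 1) (hlam : 0 < lam) : EqOn u v (Icc 0 L) := by
  have hm := hu.isPeak_half ha hL hp hp1 hlam
  have hm' := hv.isPeak_half ha hL hp hp1 hlam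
  have hmax : u (L / 2) = v (L / 2) :=
    le_antisymm (not_lt.1 (hu.not_peak_lt hv ha hp hp1 hm hm'))
      (not_lt.1 (hv.not_peak_lt hu ha hp hp1 hm' hm))
  have h0 : du 0 = dv 0 := by
    have e1 := hu.energy_peak hp hm (left_mem_Icc.2 hL.le)
    have e2 := hv.energy_peak hp hm' (left_mem_Icc.2 hL.le)
    rw [hu.left, hmax] at e1
    rw [hv.left, ← e1] at e2
    exact ((sq_eq_sq₀ hv.deriv_left.le hu.deriv_left.le).1 e2).symm
  have he := hu.eqOn_of_deriv_left_eq hv ha hp hlam hm hm' le_rfl h0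
  intro x hx
  rcases le_total x (L / 2) with hle | hle
  · exact he ⟨hx.1, hle⟩
  · rw [← hu.symm ha hL hp hp1 hlam hx, ← hv.symm ha hL hp hp1 hlam hx]
    exact he ⟨by linarith [hx.2], by linarith⟩

lemma rpow_lt_peak (h : IsPosSol a L p lam u du) (ha : 0 < a) (hp : 0 < p) (hp1 : p < 1)
    (hlam : 0 < lam) (hm : IsPeak L du m) :
    (2 * a / ((p + 1) * lam)) ^ (1 / (1 - p)) < u m := by
  obtain ⟨hpos, hlt⟩ := h.lt_of_deriv_eq_zero hp (Ioo_subset_Icc_self hm.mem) hm.zero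
  rw [one_div, Real.rpow_inv_lt_iff_of_pos (by positivity) hpos.le (by linarith),
    Real.rpow_sub hpos, Real.rpow_one, div_lt_div_iff₀ (by positivity) (by positivity)]
  rw [div_mul_eq_mul_div, div_lt_iff₀ (by linarith)] at hlt
  linarith

lemma sq_pi_div_lt (h : IsPosSol a L p lam u du) (ha : 0 < a) (hL : 0 < L) :
    (Real.pi / L) ^ 2 < lam := by
  by_contra! hle
  obtain ⟨ω, hω⟩ : ∃ ω, ω = Real.pi / L := ⟨_, rfl⟩
  have hωL : ω * L = Real.pi := by rw [hω]; field_simp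
  have hω0 : 0 < ω := hω ▸ div_pos Real.pi_pos hL
  rw [← hω] at hle
  have hs : ∀ x, HasDerivAt (fun x => Real.sin (ω * x)) (Real.cos (ω * x) * ω) x := fun x => by
    simpa using ((hasDerivAt_id x).const_mul ω).sin
  have hc : ∀ x, HasDerivAt (fun x => Real.cos (ω * x)) (-Real.sin (ω * x) * ω) x := fun x => by
    simpa using ((hasDerivAt_id x).const_mul ω).cos
  have hmono : StrictMonoOn
      (fun x => du x * Real.sin (ω * x) - u x * (Real.cos (ω * x) * ω)) (Icc 0 L) := by
    refine strictMonoOn_of_hasDerivWithinAt_pos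
      (f' := fun x => (a * u x ^ p + (ω ^ 2 - lam) * u x) * Real.sin (ω * x)) (convex_Icc _ _)
      ((h.continuousOn_deriv.mul (by fun_prop)).sub (h.continuousOn.mul (by fun_prop)))
      (fun x hx => ?_) (fun x hx => ?_)
    · rw [interior_Icc] at hx
      convert! (((h.hasDerivAt_deriv hx).mul (hs x)).sub
        ((h.hasDerivAt hx).mul ((hc x).mul_const ω))).hasDerivWithinAt using 1
      ring
    · rw [interior_Icc] at hx
      have hsin : 0 < Real.sin (ω * x) := Real.sin_pos_of_pos_of_lt_pi (mul_pos hω0 hx.1)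
        (by rw [← hωL]; exact mul_lt_mul_of_pos_left hx.2 hω0)
      have hux := h.pos x hx
      have : 0 ≤ ω ^ 2 - lam := by linarith
      positivity
  have := hmono ⟨le_rfl, hL.le⟩ ⟨hL.le, le_rfl⟩ hL
  simp [h.left, h.right, hωL] at this

/-- Comparison with the zero-energy solution `sin ^ (2 / (1 - p))`, through the phase
`arcsin ((u / u m) ^ ((1 - p) / 2))`. -/
lemma mul_sqrt_mul_peak_lt (h : IsPosSol a L p lam u du) (hp : 0 < p) (hp1 : p < 1)
    (hlam : 0 < lam) (hm : IsPeak L du m) : (1 - p) / 2 * √lam * m < Real.pi / 2 := by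
  have hm0 := hm.mem.1
  have hmL := hm.mem.2
  obtain ⟨hM, hMlt⟩ := h.lt_of_deriv_eq_zero hp (Ioo_subset_Icc_self hm.mem) hm.zero
  have hk : 0 < (1 - p) / 2 := by linarith
  set k := (1 - p) / 2
  obtain ⟨ξ, hξ, hslope⟩ := exists_hasDerivAt_eq_slope
    (fun x => Real.arcsin ((u x / u m) ^ k))
    (fun x => 1 / √(1 - ((u x / u m) ^ k) ^ 2) * (du x / u m * k * (u x / u m) ^ (k - 1))) hm0
    (Real.continuous_arcsin.comp_continuousOn
      (((h.continuousOn.mono (Icc_subset_Icc_right hmL.le)).div_const _).rpow_const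
        fun x _ => Or.inr hk.le))
    (fun x hx => by
      have hxL : x ∈ Ioo 0 L := ⟨hx.1, hx.2.trans hmL⟩
      have hs0 : 0 < u x / u m := div_pos (h.pos x hxL) hM
      have hs1 : u x / u m < 1 :=
        (div_lt_one hM).2 (h.lt_peak hm (Ioo_subset_Icc_self hxL) hx.2.ne)
      exact (Real.hasDerivAt_arcsin (by linarith [Real.rpow_pos_of_pos hs0 k])
        (Real.rpow_lt_one hs0.le hs1 hk).ne).comp x
        (((h.hasDerivAt hxL).div_const _).rpow_const (Or.inl hs0.ne')))
  have hξL : ξ ∈ Ioo 0 L := ⟨hξ.1, hξ.2.trans hmL⟩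
  have hs1 : u ξ / u m < 1 :=
    (div_lt_one hM).2 (h.lt_peak hm (Ioo_subset_Icc_self hξL) hξ.2.ne)
  have hs0 : 0 < u ξ / u m := div_pos (h.pos ξ hξL) hM
  have hus : u ξ = u ξ / u m * u m := by field_simp
  have hd : 0 < du ξ := hm.pos ξ (Ioo_subset_Ico_self hξ)
  have he := h.energy_peak hp hm (Ioo_subset_Icc_self hξL)
  rw [h.left, div_self hM.ne', zero_div, Real.one_rpow, Real.zero_rpow hk.ne', Real.arcsin_one,
    Real.arcsin_zero, sub_zero, sub_zero] at hslope
  obtain ⟨s, hs⟩ : ∃ s, s = u ξ / u m := ⟨_, rfl⟩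
  rw [← hs] at hs0 hs1 hus hslope
  rw [hus, Real.mul_rpow hs0.le hM.le] at he
  have hw0 : 0 < s ^ k := Real.rpow_pos_of_pos hs0 k
  have hw1 : s ^ k < 1 := Real.rpow_lt_one hs0.le hs1 hk
  have hw : (s ^ k) ^ 2 * s ^ p = s := by
    rw [← Real.rpow_natCast, ← Real.rpow_mul hs0.le, ← Real.rpow_add hs0]
    have : k * ((2 : ℕ) : ℝ) + p = 1 := by
      simp only [k]
      push_cast
      ring
    rw [this, Real.rpow_one]
  have hq : 0 < 1 - (s ^ k) ^ 2 := by nlinarith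
  have hsp : s ^ p * s < 1 := by
    have := Real.rpow_le_one hs0.le hs1.le hp.le
    nlinarith
  have hsq : lam * (s * u m) ^ 2 * (1 - (s ^ k) ^ 2) < (du ξ * s ^ k) ^ 2 := by
    have h1 : 2 * a / (p + 1) * u m ^ p * (u m * (1 - s ^ p * s)) <
        lam * u m * (u m * (1 - s ^ p * s)) :=
      mul_lt_mul_of_pos_right hMlt (mul_pos hM (by linarith))
    have h2 : lam * u m ^ 2 * (s ^ p * s - s ^ 2) < du ξ ^ 2 := by
      rw [he]
      linarith
    have h3 := mul_lt_mul_of_pos_right h2 (pow_pos hw0 2)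
    calc lam * (s * u m) ^ 2 * (1 - (s ^ k) ^ 2)
        = lam * u m ^ 2 * (s ^ p * s - s ^ 2) * (s ^ k) ^ 2 := by
          linear_combination (-(lam * u m ^ 2 * s)) * hw
      _ < _ := by rw [mul_pow]; exact h3
  have hroot : √lam * (s * u m) * √(1 - (s ^ k) ^ 2) < du ξ * s ^ k := by
    refine lt_of_pow_lt_pow_left₀ 2 (by positivity) ?_
    rw [mul_pow, mul_pow, Real.sq_sqrt hlam.le, Real.sq_sqrt hq.le]
    exact hsq
  have hlow : k * √lam <
      1 / √(1 - (s ^ k) ^ 2) * (du ξ / u m * k * s ^ (k - 1)) := by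
    rw [Real.rpow_sub_one hs0.ne']
    have : 1 / √(1 - (s ^ k) ^ 2) * (du ξ / u m * k * (s ^ k / s)) =
        k * (du ξ * s ^ k) / (s * u m * √(1 - (s ^ k) ^ 2)) := by
      field_simp
    have hr := Real.sqrt_pos.2 hq
    rw [this, lt_div_iff₀ (by positivity)]
    linarith [mul_lt_mul_of_pos_left hroot hk]
  rw [hslope, lt_div_iff₀ hm0] at hlow
  exact hlow

end IsPosSol

theorem stmt8 (a L p lam : ℝ) (ha : 0 < a) (hL : 0 < L) (hp0 : 0 < p) (hp1 : p < 1)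
    (hlam : 0 < lam) (u : ℝ → ℝ) (hu : IsClassicalPositiveSolution a L p lam u) :
    ((Real.pi / L) ^ 2 < lam ∧ lam < (2 / (1 - p)) ^ 2 * (Real.pi / L) ^ 2) ∧
    (∀ v : ℝ → ℝ, IsClassicalPositiveSolution a L p lam v →
      ∀ x ∈ Set.Icc (0 : ℝ) L, v x = u x) ∧
    (∀ x ∈ Set.Icc (0 : ℝ) L, u (L - x) = u x) ∧
    (∀ x ∈ Set.Icc (0 : ℝ) L, x ≠ L / 2 → u x < u (L / 2)) ∧
    (2 * a / ((p + 1) * lam)) ^ (1 / (1 - p)) < u (L / 2) := by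
  have h := hu.isPosSol hL
  have hm := h.isPeak_half ha hL hp0 hp1 hlam
  refine ⟨⟨h.sq_pi_div_lt ha hL, ?_⟩,
    fun v hv => (hv.isPosSol hL).eqOn h ha hL hp0 hp1 hlam,
    fun x hx => h.symm ha hL hp0 hp1 hlam hx, fun x hx => h.lt_peak hm hx,
    h.rpow_lt_peak ha hp0 hp1 hlam hm⟩
  have hlt : √lam < 2 / (1 - p) * (Real.pi / L) := by
    have := h.mul_sqrt_mul_peak_lt hp0 hp1 hlam hm
    rw [div_mul_div_comm, lt_div_iff₀ (mul_pos (by linarith) hL)]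
    linarith
  rw [← mul_pow]
  exact (Real.sqrt_lt' (lt_of_le_of_lt (Real.sqrt_nonneg _) hlt)).1 hlt
end

section
/- For each λ ∈ (σ₁, Σ₁(p)) let u_λ denote the unique classical positive solution of the BVP and set c(λ) := u_λ(L/2) = max u_λ. Then the map λ ↦ c(λ) is continuous and strictly decreasing on (σ₁, Σ₁(p)), c(λ) → +∞ as λ ↓ σ₁, and c(λ) → (2a/(Σ₁(p)·(p+1)))^{1/(1−p)} as λ ↑ Σ₁(p). -/
section TimeMap

open Real Set Filter Topology

/-- The slope `(1 - s ^ (p + 1)) / (1 - s ^ 2)`, extended continuously to `s = 1`. -/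
noncomputable def chordRatio (p s : ℝ) : ℝ :=
  dslope (fun r : ℝ => r ^ (p + 1)) 1 s / (1 + s)

theorem chordRatio_one (p : ℝ) : chordRatio p 1 = (p + 1) / 2 := by
  have h := (Real.hasDerivAt_rpow_const (x := 1) (p := p + 1) (Or.inl one_ne_zero)).deriv
  simp only [chordRatio, dslope_same, h, Real.one_rpow]
  norm_num

theorem chordRatio_of_ne {p s : ℝ} (hs : 0 ≤ s) (h1 : s ≠ 1) :
    chordRatio p s = (1 - s ^ (p + 1)) / (1 - s ^ 2) := by
  have h2 : s - 1 ≠ 0 := sub_ne_zero.2 h1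
  have h3 : 1 + s ≠ 0 := by positivity
  have h4 : 1 - s ^ 2 ≠ 0 := by
    rw [show 1 - s ^ 2 = -((s - 1) * (1 + s)) by ring]
    exact neg_ne_zero.2 (mul_ne_zero h2 h3)
  rw [chordRatio, dslope_of_ne _ h1, slope_def_field, Real.one_rpow, div_div,
    div_eq_div_iff (mul_ne_zero h2 h3) h4]
  ring

theorem one_sub_sq_mul_chordRatio {p s : ℝ} (hs : 0 ≤ s) :
    (1 - s ^ 2) * chordRatio p s = 1 - s ^ (p + 1) := by
  rcases eq_or_ne s 1 with rfl | h1
  · simp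
  · rw [chordRatio_of_ne hs h1, mul_div_cancel₀]
    intro h
    have : (1 - s) * (1 + s) = 0 := by linarith
    rcases mul_eq_zero.1 this with h | h
    · exact h1 (by linarith)
    · linarith

theorem continuousOn_chordRatio {p : ℝ} (hp : 0 < p) : ContinuousOn (chordRatio p) (Ici 0) := by
  refine ContinuousOn.div ?_ (by fun_prop) fun s hs => ?_
  · refine (continuousOn_dslope (Ici_mem_nhds one_pos)).2 ⟨?_, ?_⟩
    · exact (Real.continuous_rpow_const (by linarith)).continuousOn
    · exact (Real.hasDerivAt_rpow_const (Or.inl one_ne_zero)).differentiableAt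
  · have : (0 : ℝ) ≤ s := hs
    positivity

theorem chordRatio_pos {p s : ℝ} (hp : 0 < p) (hs : s ∈ Icc (0 : ℝ) 1) : 0 < chordRatio p s := by
  rcases hs.2.eq_or_lt with rfl | h1
  · rw [chordRatio_one]; positivity
  · rw [chordRatio_of_ne hs.1 h1.ne]
    have := Real.rpow_lt_one hs.1 h1 (by linarith : 0 < p + 1)
    have := pow_lt_one₀ hs.1 h1 two_ne_zero
    exact div_pos (by linarith) (by linarith)

theorem chordRatio_lt_one {p s : ℝ} (hp1 : p < 1) (hs : s ∈ Ioc (0 : ℝ) 1) :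
    chordRatio p s < 1 := by
  rcases hs.2.eq_or_lt with rfl | h1
  · rw [chordRatio_one]; linarith
  · rw [chordRatio_of_ne hs.1.le h1.ne]
    have h2 := pow_lt_one₀ hs.1.le h1 two_ne_zero
    have h3 := Real.rpow_lt_rpow_of_exponent_gt hs.1 h1 (by linarith : p + 1 < 2)
    rw [Real.rpow_two] at h3
    rw [div_lt_one (by linarith)]
    linarith

theorem chordRatio_le_one {p s : ℝ} (hp : 0 < p) (hp1 : p < 1) (hs : s ∈ Icc (0 : ℝ) 1) :
    chordRatio p s ≤ 1 := by
  rcases hs.1.eq_or_lt with rfl | h0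
  · rw [chordRatio_of_ne le_rfl zero_ne_one, Real.zero_rpow (by linarith)]
    norm_num
  · exact (chordRatio_lt_one hp1 ⟨h0, hs.2⟩).le

theorem abs_cos_mem_Icc (θ : ℝ) : |cos θ| ∈ Icc (0 : ℝ) 1 := ⟨abs_nonneg _, abs_cos_le_one θ⟩

/-- The phase speed of the normalised profile `cos Θ`. -/
noncomputable def phaseSpeed (p μ θ : ℝ) : ℝ := √(1 - μ * chordRatio p |cos θ|)

theorem continuous_chordRatio_abs_cos {p : ℝ} (hp : 0 < p) :
    Continuous fun θ => chordRatio p |cos θ| :=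
  (continuousOn_chordRatio hp).comp_continuous (by fun_prop) fun θ => abs_nonneg (cos θ)

theorem continuous_phaseSpeed {p : ℝ} (hp : 0 < p) (μ : ℝ) : Continuous (phaseSpeed p μ) :=
  (continuous_const.sub (continuous_const.mul (continuous_chordRatio_abs_cos hp))).sqrt

theorem one_sub_mul_chordRatio_pos {p μ : ℝ} (hp : 0 < p) (hp1 : p < 1) (hμ : μ < 1) (θ : ℝ) :
    0 < 1 - μ * chordRatio p |cos θ| := by
  have h0 := chordRatio_pos hp (abs_cos_mem_Icc θ)
  have h1 := chordRatio_le_one hp hp1 (abs_cos_mem_Icc θ)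
  nlinarith

theorem phaseSpeed_pos {p μ : ℝ} (hp : 0 < p) (hp1 : p < 1) (hμ : μ < 1) (θ : ℝ) :
    0 < phaseSpeed p μ θ :=
  Real.sqrt_pos.2 (one_sub_mul_chordRatio_pos hp hp1 hμ θ)

theorem phaseSpeed_le_one {p μ : ℝ} (hp : 0 < p) (hμ : 0 ≤ μ) (θ : ℝ) :
    phaseSpeed p μ θ ≤ 1 := by
  rw [phaseSpeed, Real.sqrt_le_one]
  have := mul_nonneg hμ (chordRatio_pos hp (abs_cos_mem_Icc θ)).le
  linarith

/-- A quarter of the period of the normalised oscillator. -/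
noncomputable def quarterPeriod (p μ : ℝ) : ℝ := ∫ θ in (0)..(π / 2), (phaseSpeed p μ θ)⁻¹

theorem continuous_phaseSpeed_inv {p μ : ℝ} (hp : 0 < p) (hp1 : p < 1) (hμ : μ < 1) :
    Continuous fun θ => (phaseSpeed p μ θ)⁻¹ :=
  (continuous_phaseSpeed hp μ).inv₀ fun θ => (phaseSpeed_pos hp hp1 hμ θ).ne'

theorem quarterPeriod_zero (p : ℝ) : quarterPeriod p 0 = π / 2 := by
  simp [quarterPeriod, phaseSpeed]

theorem strictMonoOn_quarterPeriod {p : ℝ} (hp : 0 < p) (hp1 : p < 1) :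
    StrictMonoOn (quarterPeriod p) (Iio 1) := by
  intro μ hμ ν hν hlt
  have key : ∀ θ, (phaseSpeed p μ θ)⁻¹ < (phaseSpeed p ν θ)⁻¹ := by
    intro θ
    refine inv_strictAnti₀ (phaseSpeed_pos hp hp1 hν θ) (Real.sqrt_lt_sqrt ?_ ?_)
    · exact (one_sub_mul_chordRatio_pos hp hp1 hν θ).le
    · have := mul_lt_mul_of_pos_right hlt (chordRatio_pos hp (abs_cos_mem_Icc θ))
      linarith
  exact intervalIntegral.integral_lt_integral_of_continuousOn_of_le_of_exists_lt
    (by positivity) (continuous_phaseSpeed_inv hp hp1 hμ).continuousOn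
    (continuous_phaseSpeed_inv hp hp1 hν).continuousOn (fun θ _ => (key θ).le)
    ⟨0, ⟨le_rfl, by positivity⟩, key 0⟩

theorem continuousOn_integral_inv_sqrt {h : ℝ → ℝ} (hc : Continuous h) {S : Set ℝ}
    (hpos : ∀ μ ∈ S, ∀ θ, 0 < 1 - μ * h θ) (b : ℝ) :
    ContinuousOn (fun μ => ∫ θ in (0)..b, (√(1 - μ * h θ))⁻¹) S := by
  rw [continuousOn_iff_continuous_domRestrict]
  refine intervalIntegral.continuous_parametric_intervalIntegral_of_continuous'
    (f := fun (μ : S) θ => (√(1 - (μ : ℝ) * h θ))⁻¹) ?_ 0 b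
  exact Continuous.inv₀ (by fun_prop) fun x => (Real.sqrt_pos.2 (hpos x.1 x.1.2 x.2)).ne'

theorem continuousOn_quarterPeriod {p : ℝ} (hp : 0 < p) (hp1 : p < 1) :
    ContinuousOn (quarterPeriod p) (Iio 1) :=
  continuousOn_integral_inv_sqrt (continuous_chordRatio_abs_cos hp)
    (fun _ hμ θ => one_sub_mul_chordRatio_pos hp hp1 hμ θ) _

theorem cos_pos_of_mem_Icc {b θ : ℝ} (hb : b < π / 2) (hθ : θ ∈ Icc 0 b) : 0 < cos θ :=
  cos_pos_of_mem_Ioo ⟨by linarith [hθ.1, pi_pos], by linarith [hθ.2]⟩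

theorem phaseSpeed_one_of_mem_Ioo {p θ : ℝ} (hp1 : p < 1) (hθ : θ ∈ Ioo 0 (π / 2)) :
    phaseSpeed p 1 θ =
      √(1 - (cos θ ^ ((1 - p) / 2)) ^ 2) * (cos θ ^ ((p + 1) / 2) / sin θ) := by
  have hc : 0 < cos θ := cos_pos_of_mem_Ioo ⟨by linarith [hθ.1, pi_pos], hθ.2⟩
  have hs : 0 < sin θ := sin_pos_of_pos_of_lt_pi hθ.1 (by linarith [hθ.2, pi_pos])
  have hsq : sin θ ^ 2 = 1 - cos θ ^ 2 := by linarith [sin_sq_add_cos_sq θ]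
  have hr := one_sub_sq_mul_chordRatio (p := p) hc.le
  have hc1 : cos θ < 1 := by nlinarith
  have e1 : (cos θ ^ ((1 - p) / 2)) ^ 2 = cos θ ^ (1 - p) := by
    rw [← Real.rpow_mul_natCast hc.le]; congr 1; push_cast; ring
  have e2 : (cos θ ^ ((p + 1) / 2)) ^ 2 = cos θ ^ (p + 1) := by
    rw [← Real.rpow_mul_natCast hc.le]; congr 1; push_cast; ring
  have e3 : cos θ ^ (1 - p) * cos θ ^ (p + 1) = cos θ ^ 2 := by
    rw [← Real.rpow_add hc, ← Real.rpow_two]; congr 1; ring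
  have h4 : 0 ≤ 1 - (cos θ ^ ((1 - p) / 2)) ^ 2 := by
    rw [e1]; linarith [Real.rpow_le_one hc.le hc1.le (by linarith : 0 ≤ 1 - p)]
  rw [phaseSpeed, abs_of_pos hc,
    ← Real.sqrt_sq (show 0 ≤ cos θ ^ ((p + 1) / 2) / sin θ by positivity),
    ← Real.sqrt_mul h4, div_pow, e1, e2, hsq]
  congr 1
  have h5 : 1 - cos θ ^ 2 ≠ 0 := by rw [← hsq]; positivity
  field_simp
  linear_combination hr * (-1) + e3

theorem integral_phaseSpeed_one_inv {p b : ℝ} (hp : 0 < p) (hp1 : p < 1) (hb0 : 0 ≤ b)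
    (hb : b < π / 2) :
    ∫ θ in (0)..b, (phaseSpeed p 1 θ)⁻¹ = 2 / (1 - p) * arccos (cos b ^ ((1 - p) / 2)) := by
  have hq : 0 < (1 - p) / 2 := by linarith
  have hcos : ∀ θ ∈ Icc 0 b, 0 < cos θ := fun θ => cos_pos_of_mem_Icc hb
  have hint : ContinuousOn (fun θ => (phaseSpeed p 1 θ)⁻¹) (Icc 0 b) := by
    refine (continuous_phaseSpeed hp 1).continuousOn.inv₀ fun θ hθ => ?_
    have := chordRatio_lt_one hp1
      (⟨abs_pos.2 (hcos θ hθ).ne', abs_cos_le_one θ⟩ : |cos θ| ∈ Ioc (0 : ℝ) 1)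
    exact (Real.sqrt_pos.2 (by linarith)).ne'
  rw [intervalIntegral.integral_eq_sub_of_hasDerivAt_of_le hb0
    (f := fun θ => 2 / (1 - p) * arccos (cos θ ^ ((1 - p) / 2)))]
  · simp
  · have : Continuous fun θ => cos θ ^ ((1 - p) / 2) :=
      (Real.continuous_rpow_const hq.le).comp continuous_cos
    exact (continuous_const.mul (continuous_arccos.comp this)).continuousOn
  · intro θ hθ
    have hc : 0 < cos θ := hcos θ (Ioo_subset_Icc_self hθ)
    have hs : 0 < sin θ := sin_pos_of_pos_of_lt_pi hθ.1 (by linarith [hθ.2, pi_pos])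
    have hc1 : cos θ < 1 := by nlinarith [sin_sq_add_cos_sq θ]
    have hlt := Real.rpow_lt_one hc.le hc1 hq
    have hgt := Real.rpow_pos_of_pos hc ((1 - p) / 2)
    have hr : 0 < 1 - (cos θ ^ ((1 - p) / 2)) ^ 2 := by nlinarith
    have hd := ((hasDerivAt_arccos (by linarith) hlt.ne).comp θ
      ((hasDerivAt_cos θ).rpow_const (p := (1 - p) / 2) (Or.inl hc.ne'))).const_mul (2 / (1 - p))
    refine hd.congr_deriv ?_
    rw [phaseSpeed_one_of_mem_Ioo hp1 ⟨hθ.1, by linarith [hθ.2]⟩,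
      show (1 - p) / 2 - 1 = -((p + 1) / 2) by ring, Real.rpow_neg hc.le]
    have h1 := (Real.rpow_pos_of_pos hc ((p + 1) / 2)).ne'
    have h2 := (Real.sqrt_pos.2 hr).ne'
    have h3 : 1 - p ≠ 0 := by linarith
    field_simp
  · exact (hint.mono (by rw [uIcc_of_le hb0])).intervalIntegrable

theorem tendsto_two_div_mul_arccos_cos_rpow {p : ℝ} (hp1 : p < 1) :
    Tendsto (fun b => 2 / (1 - p) * arccos (cos b ^ ((1 - p) / 2))) (𝓝[<] (π / 2))
      (𝓝 (π / (1 - p))) := by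
  have hq : 0 < (1 - p) / 2 := by linarith
  have h3 : 1 - p ≠ 0 := by linarith
  have : Continuous fun θ => cos θ ^ ((1 - p) / 2) :=
    (Real.continuous_rpow_const hq.le).comp continuous_cos
  have hc : Continuous fun b => 2 / (1 - p) * arccos (cos b ^ ((1 - p) / 2)) :=
    continuous_const.mul (continuous_arccos.comp this)
  have h := hc.tendsto (π / 2)
  simp only [cos_pi_div_two, Real.zero_rpow hq.ne', arccos_zero] at h
  rw [show 2 / (1 - p) * (π / 2) = π / (1 - p) by field_simp] at h
  exact h.mono_left nhdsWithin_le_nhds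

theorem quarterPeriod_le {p μ : ℝ} (hp : 0 < p) (hp1 : p < 1) (hμ : μ < 1) :
    quarterPeriod p μ ≤ π / (1 - p) := by
  have hc := continuous_phaseSpeed_inv hp hp1 hμ
  have h1 : Tendsto (fun b => ∫ θ in (0)..b, (phaseSpeed p μ θ)⁻¹) (𝓝[<] (π / 2))
      (𝓝 (quarterPeriod p μ)) :=
    ((intervalIntegral.continuous_primitive
      (fun a b => hc.intervalIntegrable a b) 0).tendsto (π / 2)).mono_left nhdsWithin_le_nhds
  refine le_of_tendsto_of_tendsto h1 (tendsto_two_div_mul_arccos_cos_rpow hp1) ?_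
  filter_upwards [Ioo_mem_nhdsLT (show (0 : ℝ) < π / 2 by positivity)] with b hb
  have hpos : ∀ θ ∈ Icc 0 b, 0 < 1 - 1 * chordRatio p |cos θ| := fun θ hθ => by
    have := chordRatio_lt_one hp1
      (⟨abs_pos.2 (cos_pos_of_mem_Icc hb.2 hθ).ne', abs_cos_le_one θ⟩ : |cos θ| ∈ Ioc (0 : ℝ) 1)
    linarith
  rw [← integral_phaseSpeed_one_inv hp hp1 hb.1.le hb.2]
  refine intervalIntegral.integral_mono_on hb.1.le (hc.intervalIntegrable _ _) ?_ fun θ hθ => ?_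
  · refine ContinuousOn.intervalIntegrable (ContinuousOn.inv₀
      (continuous_phaseSpeed hp 1).continuousOn fun θ hθ => ?_)
    rw [uIcc_of_le hb.1.le] at hθ
    exact (Real.sqrt_pos.2 (hpos θ hθ)).ne'
  · refine inv_anti₀ (Real.sqrt_pos.2 (hpos θ hθ)) (Real.sqrt_le_sqrt ?_)
    have := mul_le_mul_of_nonneg_right hμ.le (chordRatio_pos hp (abs_cos_mem_Icc θ)).le
    linarith

theorem exists_lt_quarterPeriod {p y : ℝ} (hp : 0 < p) (hp1 : p < 1) (hy : y < π / (1 - p)) :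
    ∃ μ ∈ Ioo (0 : ℝ) 1, y < quarterPeriod p μ := by
  obtain ⟨b, hyb, hb⟩ := (((tendsto_two_div_mul_arccos_cos_rpow hp1).eventually_const_lt hy).and
    (Ioo_mem_nhdsLT (show (0 : ℝ) < π / 2 by positivity))).exists
  rw [← integral_phaseSpeed_one_inv hp hp1 hb.1.le hb.2] at hyb
  have hcb : 0 < cos b := cos_pos_of_mem_Icc hb.2 ⟨hb.1.le, le_rfl⟩
  have hmem : ∀ θ, max |cos θ| (cos b) ∈ Ioc (0 : ℝ) 1 := fun θ =>
    ⟨lt_max_of_lt_right hcb, max_le (abs_cos_le_one θ) (cos_le_one b)⟩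
  have hcont : Continuous fun θ => chordRatio p (max |cos θ| (cos b)) :=
    (continuousOn_chordRatio hp).comp_continuous (by fun_prop) fun θ => (hmem θ).1.le
  have hJ := continuousOn_integral_inv_sqrt hcont (S := Iic 1) (fun μ hμ θ => by
    have h1 := chordRatio_lt_one hp1 (hmem θ)
    have h0 := chordRatio_pos hp ⟨(hmem θ).1.le, (hmem θ).2⟩
    have hμ' : μ ≤ 1 := hμ
    nlinarith) b
  have hEq : ∀ μ, ∫ θ in (0)..b, (√(1 - μ * chordRatio p (max |cos θ| (cos b))))⁻¹ =
      ∫ θ in (0)..b, (phaseSpeed p μ θ)⁻¹ := fun μ => by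
    refine intervalIntegral.integral_congr fun θ hθ => ?_
    rw [uIcc_of_le hb.1.le] at hθ
    have : cos b ≤ |cos θ| := (cos_le_cos_of_nonneg_of_le_pi hθ.1 (by linarith [hb.2, pi_pos])
      hθ.2).trans (le_abs_self _)
    simp only [phaseSpeed, max_eq_left this]
  simp only [hEq] at hJ
  have h1 := ((hJ 1 (mem_Iic.2 le_rfl)).mono Iio_subset_Iic_self).eventually (lt_mem_nhds hyb)
  obtain ⟨μ, hμy, hμ⟩ := (h1.and (Ioo_mem_nhdsLT (zero_lt_one' ℝ))).exists
  refine ⟨μ, hμ, hμy.trans_le ?_⟩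
  have hc := continuous_phaseSpeed_inv hp hp1 hμ.2
  exact intervalIntegral.integral_mono_interval le_rfl hb.1.le hb.2.le
    (Eventually.of_forall fun θ => (inv_pos.2 (phaseSpeed_pos hp hp1 hμ.2 θ)).le)
    (hc.intervalIntegrable _ _)

theorem image_quarterPeriod {p : ℝ} (hp : 0 < p) (hp1 : p < 1) :
    quarterPeriod p '' Ioo 0 1 = Ioo (π / 2) (π / (1 - p)) := by
  have hmono := strictMonoOn_quarterPeriod hp hp1
  apply Subset.antisymm
  · rintro _ ⟨μ, hμ, rfl⟩
    obtain ⟨ν, hμν, hν⟩ := exists_between hμ.2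
    refine ⟨?_, (hmono hμ.2 hν hμν).trans_le (quarterPeriod_le hp hp1 hν)⟩
    rw [← quarterPeriod_zero p]
    exact hmono (mem_Iio.2 one_pos) hμ.2 hμ.1
  · intro y hy
    obtain ⟨ν, hν, hyν⟩ := exists_lt_quarterPeriod hp hp1 hy.2
    have := intermediate_value_Ioo hν.1.le
      ((continuousOn_quarterPeriod hp hp1).mono fun x hx => hx.2.trans_lt hν.2)
    rw [quarterPeriod_zero] at this
    obtain ⟨μ, hμ, rfl⟩ := this ⟨hy.1, hyν⟩
    exact ⟨μ, ⟨hμ.1, hμ.2.trans hν.2⟩, rfl⟩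

theorem HasDerivAt.mul_continuousAt_of_eq_zero {f g : ℝ → ℝ} {f' x : ℝ} (hf : HasDerivAt f f' x)
    (h0 : f x = 0) (hg : ContinuousAt g x) : HasDerivAt (fun y => f y * g y) (f' * g x) x := by
  rw [hasDerivAt_iff_tendsto_slope] at hf ⊢
  refine (hf.mul (hg.tendsto.mono_left nhdsWithin_le_nhds)).congr fun y => ?_
  simp only [slope_def_field, h0]
  ring

/-- Global flow of the scalar autonomous equation `Θ' = ω Θ`, given as inverse of its time map. -/
theorem exists_phase {ω : ℝ → ℝ} (hc : Continuous ω) (h0 : ∀ θ, 0 < ω θ) (h1 : ∀ θ, ω θ ≤ 1) :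
    ∃ Θ : ℝ → ℝ, StrictMono Θ ∧ (∀ t, HasDerivAt Θ (ω (Θ t)) t) ∧
      ∀ b, Θ (∫ θ in (0)..b, (ω θ)⁻¹) = b := by
  set T : ℝ → ℝ := fun b => ∫ θ in (0)..b, (ω θ)⁻¹ with hT
  have hci : Continuous fun θ => (ω θ)⁻¹ := hc.inv₀ fun θ => (h0 θ).ne'
  have hder : ∀ b, HasDerivAt T (ω b)⁻¹ b := fun b =>
    hci.integral_hasStrictDerivAt 0 b |>.hasDerivAt
  have hmono : StrictMono T := strictMono_of_hasDerivAt_pos hder fun b => inv_pos.2 (h0 b)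
  have hmono' : Monotone fun b => T b - b := by
    refine monotone_of_hasDerivAt_nonneg (fun b => (hder b).sub (hasDerivAt_id b)) fun b => ?_
    have := (one_le_inv₀ (h0 b)).2 (h1 b)
    simpa using this
  have hT0 : T 0 = 0 := by simp [hT]
  have hTc : Continuous T := continuous_iff_continuousAt.2 fun b => (hder b).continuousAt
  have hsurj : Function.Surjective T := by
    refine hTc.surjective ?_ ?_
    · refine tendsto_atTop_mono' atTop ?_ tendsto_id
      filter_upwards [eventually_ge_atTop 0] with b hb
      have := hmono' hb
      simp only [hT0] at this
      simp only [id]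
      linarith
    · refine tendsto_atBot_mono' atBot ?_ tendsto_id
      filter_upwards [eventually_le_atBot 0] with b hb
      have := hmono' hb
      simp only [hT0] at this
      simp only [id]
      linarith
  let e := hmono.orderIsoOfSurjective T hsurj
  refine ⟨e.symm, e.symm.strictMono, fun t => ?_, fun b => e.symm_apply_apply b⟩
  have h := HasDerivAt.of_local_left_inverse (f := T) (a := t) e.symm.continuous.continuousAt
    (hder (e.symm t)) (inv_pos.2 (h0 _)).ne' (Eventually.of_forall e.apply_symm_apply)
  rwa [inv_inv] at h

theorem abs_sin_mul_phaseSpeed {p μ θ : ℝ} :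
    |sin θ| * phaseSpeed p μ θ = √(1 - cos θ ^ 2 - μ * (1 - |cos θ| ^ (p + 1))) := by
  rw [← one_sub_sq_mul_chordRatio (abs_nonneg _), sq_abs, phaseSpeed, ← Real.sqrt_sq_eq_abs,
    ← Real.sqrt_mul (sq_nonneg _), sin_sq]
  congr 1
  ring

/-- The profile `cos Θ` solves `w'' = -w + μ (p + 1) / 2 * w ^ p`. -/
theorem hasDerivAt_neg_sin_mul_phaseSpeed {p μ : ℝ} (hp : 0 < p) (hp1 : p < 1) (hμ : μ < 1)
    {Θ : ℝ → ℝ} (hΘ : ∀ t, HasDerivAt Θ (phaseSpeed p μ (Θ t)) t) {t : ℝ}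
    (ht : Θ t ∈ Icc (-(π / 2)) (π / 2)) :
    HasDerivAt (fun t => -sin (Θ t) * phaseSpeed p μ (Θ t))
      (-cos (Θ t) + μ * ((p + 1) / 2) * cos (Θ t) ^ p) t := by
  have hΘc : Continuous Θ := continuous_iff_continuousAt.2 fun t => (hΘ t).continuousAt
  rcases eq_or_ne (Θ t) 0 with h0 | h0
  · have h := ((hΘ t).sin.neg).mul_continuousAt_of_eq_zero (by simp [h0])
      ((continuous_phaseSpeed hp μ).comp hΘc).continuousAt
    refine h.congr_deriv ?_
    have hpos := (one_sub_mul_chordRatio_pos hp hp1 hμ 0).le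
    simp only [cos_zero, abs_one, chordRatio_one] at hpos
    simp only [Function.comp, h0, phaseSpeed, cos_zero, abs_one, chordRatio_one, Real.one_rpow]
    linear_combination -Real.mul_self_sqrt hpos
  have hcos : 0 ≤ cos (Θ t) := cos_nonneg_of_mem_Icc ht
  have hder : HasDerivAt (fun t => 1 - cos (Θ t) ^ 2 - μ * (1 - |cos (Θ t)| ^ (p + 1)))
      (sin (Θ t) * phaseSpeed p μ (Θ t) *
        (2 * cos (Θ t) - μ * ((p + 1) * cos (Θ t) ^ p))) t := by
    have hc := (hΘ t).cos
    have habs := (hasDerivAt_abs_rpow (cos (Θ t)) (by linarith : 1 < p + 1)).comp t hc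
    have hpow : |cos (Θ t)| ^ (p + 1 - 2) * cos (Θ t) = cos (Θ t) ^ p := by
      rw [abs_of_nonneg hcos]
      rcases hcos.eq_or_lt with h | h
      · simp [← h, Real.zero_rpow hp.ne']
      · rw [← Real.rpow_add_one h.ne']; congr 1; ring
    refine (((hc.pow 2).const_sub 1).sub ((habs.const_sub 1).const_mul μ)).congr_deriv ?_
    rw [mul_assoc (p + 1), hpow]
    simp
    ring
  have hω := phaseSpeed_pos hp hp1 hμ (Θ t)
  have hsin : ∀ σ : ℝ, (∀ᶠ s in 𝓝 t, |sin (Θ s)| = σ * sin (Θ s)) → σ ^ 2 = 1 →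
      sin (Θ t) ≠ 0 → HasDerivAt (fun t => -sin (Θ t) * phaseSpeed p μ (Θ t))
      (-cos (Θ t) + μ * ((p + 1) / 2) * cos (Θ t) ^ p) t := by
    intro σ hσ hσ2 hne
    have hval := abs_sin_mul_phaseSpeed (p := p) (μ := μ) (θ := Θ t)
    have hpos : 0 < √(1 - cos (Θ t) ^ 2 - μ * (1 - |cos (Θ t)| ^ (p + 1))) := by
      rw [← hval]; exact mul_pos (abs_pos.2 hne) hω
    have hd := (hder.sqrt (Real.sqrt_pos.1 hpos).ne').const_mul (-σ)
    refine (hd.congr_of_eventuallyEq ?_).congr_deriv ?_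
    · filter_upwards [hσ] with s hs
      rw [← abs_sin_mul_phaseSpeed, hs]
      linear_combination (-hσ2) * (sin (Θ s) * phaseSpeed p μ (Θ s)) * (-1)
    · rw [← hval, hσ.self_of_nhds]
      have hσ0 : σ ≠ 0 := by rintro rfl; norm_num at hσ2
      have := hω.ne'
      field_simp
      ring
  have hsc : Continuous fun s => sin (Θ s) := continuous_sin.comp hΘc
  rcases h0.lt_or_gt with h | h
  · have hs : sin (Θ t) < 0 := sin_neg_of_neg_of_neg_pi_lt h (by linarith [ht.1, pi_pos])
    refine hsin (-1) ?_ (by norm_num) hs.ne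
    filter_upwards [hsc.continuousAt.eventually (gt_mem_nhds hs)] with s hs
    rw [abs_of_neg hs]; ring
  · have hs : 0 < sin (Θ t) := sin_pos_of_pos_of_lt_pi h (by linarith [ht.2, pi_pos])
    refine hsin 1 ?_ (by norm_num) hs.ne'
    filter_upwards [hsc.continuousAt.eventually (lt_mem_nhds hs)] with s hs
    rw [abs_of_pos hs]; ring

theorem exists_profile {p μ : ℝ} (hp : 0 < p) (hp1 : p < 1) (hμ : μ ∈ Ioo (0 : ℝ) 1) :
    ∃ w w' : ℝ → ℝ, (∀ t, HasDerivAt w (w' t) t) ∧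
      (∀ t ∈ Icc (-quarterPeriod p μ) (quarterPeriod p μ), 0 ≤ w t ∧
        HasDerivAt w' (-w t + μ * ((p + 1) / 2) * w t ^ p) t) ∧
      (∀ t ∈ Ioo (-quarterPeriod p μ) (quarterPeriod p μ), 0 < w t) ∧
      w (-quarterPeriod p μ) = 0 ∧ w (quarterPeriod p μ) = 0 ∧ w 0 = 1 ∧ (∀ t, w t ≤ 1) ∧
      0 < w' (-quarterPeriod p μ) ∧ w' (quarterPeriod p μ) < 0 := by
  obtain ⟨Θ, hmono, hΘ, hinv⟩ := exists_phase (continuous_phaseSpeed hp μ)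
    (phaseSpeed_pos hp hp1 hμ.2) (phaseSpeed_le_one hp hμ.1.le)
  have h0 : Θ 0 = 0 := by simpa using hinv 0
  have hR : Θ (quarterPeriod p μ) = π / 2 := hinv _
  have hL : Θ (-quarterPeriod p μ) = -(π / 2) := by
    rw [← hinv (-(π / 2))]
    congr 1
    have h := intervalIntegral.integral_comp_neg (a := 0) (b := π / 2)
      fun θ => (phaseSpeed p μ θ)⁻¹
    rw [neg_zero] at h
    rw [intervalIntegral.integral_symm, ← h]
    simp only [quarterPeriod, phaseSpeed, cos_neg]
  have hωR := phaseSpeed_pos hp hp1 hμ.2 (π / 2)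
  have hωL := phaseSpeed_pos hp hp1 hμ.2 (-(π / 2))
  refine ⟨fun t => cos (Θ t), fun t => -sin (Θ t) * phaseSpeed p μ (Θ t),
    fun t => (hΘ t).cos, fun t ht => ?_, fun t ht => ?_, by simp [hL], by simp [hR], by simp [h0],
    fun t => cos_le_one _, by simpa [hL] using hωL, by simpa [hR] using hωR⟩
  · have hm : Θ t ∈ Icc (-(π / 2)) (π / 2) := by
      rw [← hL, ← hR]; exact ⟨hmono.monotone ht.1, hmono.monotone ht.2⟩
    exact ⟨cos_nonneg_of_mem_Icc hm, hasDerivAt_neg_sin_mul_phaseSpeed hp hp1 hμ.2 hΘ hm⟩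
  · refine cos_pos_of_mem_Ioo ?_
    rw [← hL, ← hR]; exact ⟨hmono ht.1, hmono ht.2⟩

end TimeMap

section Solutions

open Real Set Filter Topology

theorem contDiffOn_two_of_hasDerivWithinAt {u u' u'' : ℝ → ℝ} {a b : ℝ} (hab : a < b)
    (h1 : ∀ x ∈ Icc a b, HasDerivWithinAt u (u' x) (Icc a b) x)
    (h2 : ∀ x ∈ Icc a b, HasDerivWithinAt u' (u'' x) (Icc a b) x)
    (h3 : ContinuousOn u'' (Icc a b)) :
    ContDiffOn ℝ 2 u (Icc a b) ∧ ∀ x ∈ Icc a b, iteratedDerivWithin 2 u (Icc a b) x = u'' x := by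
  have hU := uniqueDiffOn_Icc hab
  have e1 : EqOn (derivWithin u (Icc a b)) u' (Icc a b) := fun x hx =>
    (h1 x hx).derivWithin (hU x hx)
  have e2 : EqOn (derivWithin u' (Icc a b)) u'' (Icc a b) := fun x hx =>
    (h2 x hx).derivWithin (hU x hx)
  have e3 : EqOn (iteratedDerivWithin 2 u (Icc a b)) u'' (Icc a b) := fun x hx => by
    rw [iteratedDerivWithin_succ, iteratedDerivWithin_one, derivWithin_congr e1 (e1 hx)]
    exact e2 hx
  have d1 : DifferentiableOn ℝ u (Icc a b) := fun x hx => (h1 x hx).differentiableWithinAt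
  have d2 : DifferentiableOn ℝ u' (Icc a b) := fun x hx => (h2 x hx).differentiableWithinAt
  refine ⟨?_, e3⟩
  refine contDiffOn_of_continuousOn_differentiableOn_deriv (n := 2) (fun m hm => ?_) fun m hm => ?_
  · have hm : m ≤ 2 := by exact_mod_cast hm
    interval_cases m
    · simpa using d1.continuousOn
    · rw [iteratedDerivWithin_one]; exact d2.continuousOn.congr e1
    · exact h3.congr e3
  · have hm : m < 2 := by exact_mod_cast hm
    interval_cases m
    · simpa using d1
    · rw [iteratedDerivWithin_one]; exact d2.congr e1

theorem exists_isClassicalPositiveSolution {a L p lam μ M : ℝ} (hL : 0 < L) (hp : 0 < p)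
    (hp1 : p < 1) (hlam : 0 < lam) (hμ : μ ∈ Ioo (0 : ℝ) 1) (hM : 0 < M)
    (hT : quarterPeriod p μ = √lam * (L / 2)) (hMa : lam * μ * ((p + 1) / 2) * M ^ (1 - p) = a) :
    ∃ u : ℝ → ℝ, IsClassicalPositiveSolution a L p lam u ∧ u (L / 2) = M ∧
      ∀ x ∈ Icc (0 : ℝ) L, u x ≤ M := by
  obtain ⟨w, w', hw, hw2, hpos, hwl, hwr, hw0, hw1, hl, hr⟩ := exists_profile hp hp1 hμ
  rw [hT] at hw2 hpos hwl hwr hl hr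
  set k := √lam with hk
  have hk0 : 0 < k := Real.sqrt_pos.2 hlam
  have hk2 : k * k = lam := Real.mul_self_sqrt hlam.le
  have hlin : ∀ x, HasDerivAt (fun x => k * (x - L / 2)) k x := fun x => by
    simpa using ((hasDerivAt_id x).sub_const (L / 2)).const_mul k
  have hmem : ∀ x ∈ Icc (0 : ℝ) L, k * (x - L / 2) ∈ Icc (-(k * (L / 2))) (k * (L / 2)) :=
    fun x hx => ⟨by nlinarith [mul_nonneg hk0.le hx.1],
      mul_le_mul_of_nonneg_left (by linarith [hx.2]) hk0.le⟩
  have hleft : k * (0 - L / 2) = -(k * (L / 2)) := by ring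
  have hright : k * (L - L / 2) = k * (L / 2) := by ring
  have hd1 : ∀ x, HasDerivAt (fun x => M * w (k * (x - L / 2)))
      (M * k * w' (k * (x - L / 2))) x := fun x =>
    (((hw _).comp x (hlin x)).const_mul M).congr_deriv (by ring)
  have hd2 : ∀ x ∈ Icc (0 : ℝ) L, HasDerivAt (fun x => M * k * w' (k * (x - L / 2)))
      (-lam * (M * w (k * (x - L / 2))) + a * (M * w (k * (x - L / 2))) ^ p) x := by
    intro x hx
    have hx' := hw2 _ (hmem x hx)
    refine ((hx'.2.comp x (hlin x)).const_mul (M * k)).congr_deriv ?_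
    rw [Real.mul_rpow hM.le hx'.1, ← hMa, ← hk2]
    have : M ^ (1 - p) * M ^ p = M := by rw [← Real.rpow_add hM]; simp
    linear_combination (-(k * k * μ * ((p + 1) / 2) * w (k * (x - L / 2)) ^ p)) * this
  have hc1 : Continuous fun x => M * w (k * (x - L / 2)) :=
    continuous_iff_continuousAt.2 fun x => (hd1 x).continuousAt
  have hc2 : Continuous fun x => -lam * (M * w (k * (x - L / 2))) +
      a * (M * w (k * (x - L / 2))) ^ p :=
    (continuous_const.mul hc1).add
      (continuous_const.mul ((Real.continuous_rpow_const hp.le).comp hc1))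
  obtain ⟨hC, hiter⟩ := contDiffOn_two_of_hasDerivWithinAt hL
    (fun x _ => (hd1 x).hasDerivWithinAt) (fun x hx => (hd2 x hx).hasDerivWithinAt) hc2.continuousOn
  have hU := uniqueDiffOn_Icc hL
  have h0m : (0 : ℝ) ∈ Icc 0 L := ⟨le_rfl, hL.le⟩
  have hLm : L ∈ Icc 0 L := ⟨hL.le, le_rfl⟩
  refine ⟨fun x => M * w (k * (x - L / 2)), ⟨⟨hC, fun x hx => ?_, ?_, ?_, fun x hx => ?_⟩,
    fun x hx => ?_, ?_, ?_⟩, ?_, fun x _ => ?_⟩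
  · exact mul_nonneg hM.le (hw2 _ (hmem x hx)).1
  · simp only [hleft, hwl, mul_zero]
  · simp only [hright, hwr, mul_zero]
  · rw [hiter x hx]; ring
  · exact mul_pos hM (hpos _ ⟨by nlinarith [mul_pos hk0 hx.1],
      mul_lt_mul_of_pos_left (by linarith [hx.2]) hk0⟩)
  · rw [(hd1 0).hasDerivWithinAt.derivWithin (hU 0 h0m), hleft]; positivity
  · rw [(hd1 L).hasDerivWithinAt.derivWithin (hU L hLm), hright]
    exact mul_neg_of_pos_of_neg (by positivity) hr
  · simp [hw0]
  · exact mul_le_of_le_one_right hM.le (hw1 _)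

theorem StrictMonoOn.exists_inverse_Ioo {f : ℝ → ℝ} {α β A B : ℝ} (hαβ : α < β)
    (hf : StrictMonoOn f (Ioo α β)) (him : f '' Ioo α β = Ioo A B) :
    ∃ g : ℝ → ℝ, StrictMonoOn g (Ioo A B) ∧ ContinuousOn g (Ioo A B) ∧
      (∀ y ∈ Ioo A B, g y ∈ Ioo α β ∧ f (g y) = y) ∧
      Tendsto g (𝓝[>] A) (𝓝 α) ∧ Tendsto g (𝓝[<] B) (𝓝 β) := by
  have hex : ∀ y, ∃ x, y ∈ Ioo A B → x ∈ Ioo α β ∧ f x = y := fun y => by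
    by_cases hy : y ∈ Ioo A B
    · obtain ⟨x, hx⟩ := him.symm ▸ hy
      exact ⟨x, fun _ => hx⟩
    · exact ⟨0, fun h => absurd h hy⟩
  choose g hg using hex
  have hfm : ∀ x ∈ Ioo α β, f x ∈ Ioo A B := fun x hx => him ▸ mem_image_of_mem f hx
  have hlt : ∀ y ∈ Ioo A B, ∀ x ∈ Ioo α β, (g y < x ↔ y < f x) := fun y hy x hx => by
    rw [← hf.lt_iff_lt (hg y hy).1 hx, (hg y hy).2]
  have hgt : ∀ y ∈ Ioo A B, ∀ x ∈ Ioo α β, (x < g y ↔ f x < y) := fun y hy x hx => by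
    rw [← hf.lt_iff_lt hx (hg y hy).1, (hg y hy).2]
  obtain ⟨x₀, hx₀⟩ := exists_between hαβ
  have hAB : A < B := (hfm x₀ hx₀).1.trans (hfm x₀ hx₀).2
  refine ⟨g, fun y hy z hz hyz => ?_, fun y hy => ?_, hg, ?_, ?_⟩
  · rw [hlt y hy _ (hg z hz).1, (hg z hz).2]; exact hyz
  · refine tendsto_order.2 ⟨fun m hm => ?_, fun m hm => ?_⟩
    · obtain ⟨x, hx1, hx2⟩ := exists_between (max_lt hm (hg y hy).1.1)
      have hx : x ∈ Ioo α β := ⟨(le_max_right _ _).trans_lt hx1, hx2.trans (hg y hy).1.2⟩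
      filter_upwards [self_mem_nhdsWithin,
        mem_nhdsWithin_of_mem_nhds (Ioi_mem_nhds ((hgt y hy x hx).1 hx2))] with z hz hfz
      exact ((le_max_left _ _).trans_lt hx1).trans ((hgt z hz x hx).2 hfz)
    · obtain ⟨x, hx1, hx2⟩ := exists_between (lt_min hm (hg y hy).1.2)
      have hx : x ∈ Ioo α β := ⟨(hg y hy).1.1.trans hx1, hx2.trans_le (min_le_right _ _)⟩
      filter_upwards [self_mem_nhdsWithin,
        mem_nhdsWithin_of_mem_nhds (Iio_mem_nhds ((hlt y hy x hx).1 hx1))] with z hz hfz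
      exact ((hlt z hz x hx).2 hfz).trans (hx2.trans_le (min_le_left _ _))
  · refine tendsto_order.2 ⟨fun m hm => ?_, fun m hm => ?_⟩
    · filter_upwards [Ioo_mem_nhdsGT hAB] with z hz
      exact hm.trans (hg z hz).1.1
    · obtain ⟨x, hx1, hx2⟩ := exists_between (lt_min hm hαβ)
      have hx : x ∈ Ioo α β := ⟨hx1, hx2.trans_le (min_le_right _ _)⟩
      filter_upwards [Ioo_mem_nhdsGT (hfm x hx).1] with z hz
      exact ((hlt z ⟨hz.1, hz.2.trans (hfm x hx).2⟩ x hx).2 hz.2).trans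
        (hx2.trans_le (min_le_left _ _))
  · refine tendsto_order.2 ⟨fun m hm => ?_, fun m hm => ?_⟩
    · obtain ⟨x, hx1, hx2⟩ := exists_between (max_lt hm hαβ)
      have hx : x ∈ Ioo α β := ⟨(le_max_right _ _).trans_lt hx1, hx2⟩
      filter_upwards [Ioo_mem_nhdsLT (hfm x hx).2] with z hz
      exact ((le_max_left _ _).trans_lt hx1).trans
        ((hgt z ⟨(hfm x hx).1.trans hz.1, hz.2⟩ x hx).2 hz.1)
    · filter_upwards [Ioo_mem_nhdsLT hAB] with z hz
      exact (hg z hz).1.2.trans hm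

theorem image_sq_quarterPeriod {L p : ℝ} (hL : 0 < L) (hp : 0 < p) (hp1 : p < 1) :
    (fun μ => (2 * quarterPeriod p μ / L) ^ 2) '' Ioo 0 1 =
      Ioo ((π / L) ^ 2) ((2 / (1 - p)) ^ 2 * (π / L) ^ 2) := by
  have hq : 0 < 1 - p := by linarith
  have hcomp : (fun μ => (2 * quarterPeriod p μ / L) ^ 2) =
      (fun y => (2 * y / L) ^ 2) ∘ quarterPeriod p := rfl
  rw [hcomp, image_comp, image_quarterPeriod hp hp1]
  have e1 : (π / L) ^ 2 = (2 * (π / 2) / L) ^ 2 := by ring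
  have e2 : (2 / (1 - p)) ^ 2 * (π / L) ^ 2 = (2 * (π / (1 - p)) / L) ^ 2 := by field_simp
  rw [e2, e1]
  have hA : 0 < π / 2 := by positivity
  have hB : 0 < π / (1 - p) := by positivity
  apply Subset.antisymm
  · rintro _ ⟨y, hy, rfl⟩
    have hy0 := hA.trans hy.1
    have h1 := hy.1
    have h2 := hy.2
    constructor <;> dsimp only <;> gcongr
  · intro l hl
    have hl0 : 0 < l := lt_of_le_of_lt (sq_nonneg _) hl.1
    have hl2 : (2 * (√l * L / 2) / L) ^ 2 = l := by
      rw [show 2 * (√l * L / 2) / L = √l by field_simp, Real.sq_sqrt hl0.le]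
    refine ⟨√l * L / 2, ⟨?_, ?_⟩, hl2⟩
    · have := lt_of_pow_lt_pow_left₀ 2 (Real.sqrt_nonneg l)
        (hl.1.trans_eq (Real.sq_sqrt hl0.le).symm)
      rw [div_lt_iff₀ hL] at this
      linarith
    · have := lt_of_pow_lt_pow_left₀ 2 (by positivity) ((Real.sq_sqrt hl0.le).trans_lt hl.2)
      rw [lt_div_iff₀ hL] at this
      linarith

end Solutions

theorem stmt9 (a L p : ℝ) (ha : 0 < a) (hL : 0 < L) (hp0 : 0 < p) (hp1 : p < 1) :
    ∃ c : ℝ → ℝ,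
      (∀ lam ∈ Set.Ioo ((Real.pi / L) ^ 2) ((2 / (1 - p)) ^ 2 * (Real.pi / L) ^ 2),
        ∃ u : ℝ → ℝ, IsClassicalPositiveSolution a L p lam u ∧
          u (L / 2) = c lam ∧ ∀ x ∈ Set.Icc (0 : ℝ) L, u x ≤ c lam) ∧
      ContinuousOn c
        (Set.Ioo ((Real.pi / L) ^ 2) ((2 / (1 - p)) ^ 2 * (Real.pi / L) ^ 2)) ∧
      StrictAntiOn c
        (Set.Ioo ((Real.pi / L) ^ 2) ((2 / (1 - p)) ^ 2 * (Real.pi / L) ^ 2)) ∧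
      Filter.Tendsto c
        (nhdsWithin ((Real.pi / L) ^ 2) (Set.Ioi ((Real.pi / L) ^ 2))) Filter.atTop ∧
      Filter.Tendsto c
        (nhdsWithin ((2 / (1 - p)) ^ 2 * (Real.pi / L) ^ 2)
          (Set.Iio ((2 / (1 - p)) ^ 2 * (Real.pi / L) ^ 2)))
        (nhds ((2 * a / (((2 / (1 - p)) ^ 2 * (Real.pi / L) ^ 2) * (p + 1)))
          ^ (1 / (1 - p)))) := by
  have hq : 0 < 1 - p := by linarith
  have hπ := Real.pi_pos
  have hFpos : ∀ μ ∈ Set.Ioo (0 : ℝ) 1, 0 < quarterPeriod p μ := fun μ hμ => by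
    have : quarterPeriod p μ ∈ Set.Ioo (Real.pi / 2) (Real.pi / (1 - p)) :=
      image_quarterPeriod hp0 hp1 ▸ Set.mem_image_of_mem _ hμ
    exact lt_trans (by positivity) this.1
  have hmono : StrictMonoOn (fun μ => (2 * quarterPeriod p μ / L) ^ 2) (Set.Ioo 0 1) := by
    intro μ hμ ν hν hlt
    have h1 := strictMonoOn_quarterPeriod hp0 hp1 hμ.2 hν.2 hlt
    have h2 := hFpos μ hμ
    dsimp only
    gcongr
  obtain ⟨g, hg, hgc, hgf, hgA, hgB⟩ :=
    hmono.exists_inverse_Ioo one_pos (image_sq_quarterPeriod hL hp0 hp1)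
  set A := (Real.pi / L) ^ 2 with hA
  set B := (2 / (1 - p)) ^ 2 * A with hB
  have hA0 : 0 < A := by positivity
  have hB0 : 0 < B := by positivity
  have hpos : ∀ l ∈ Set.Ioo A B, 0 < l * g l * (p + 1) := fun l hl =>
    mul_pos (mul_pos (hA0.trans hl.1) (hgf l hl).1.1) (by linarith)
  have hq' : 0 < 1 / (1 - p) := by positivity
  have hAB : A < B := by
    have : 1 < 2 / (1 - p) := by rw [lt_div_iff₀ hq]; linarith
    exact lt_mul_of_one_lt_left hA0 (one_lt_pow₀ this two_ne_zero)
  refine ⟨fun l => (2 * a / (l * g l * (p + 1))) ^ (1 / (1 - p)), fun l hl => ?_, ?_, ?_, ?_, ?_⟩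
  · obtain ⟨hμ, hl2⟩ := hgf l hl
    have hl0 : 0 < l := hA0.trans hl.1
    have hbase : 0 < 2 * a / (l * g l * (p + 1)) := div_pos (by positivity) (hpos l hl)
    refine exists_isClassicalPositiveSolution hL hp0 hp1 hl0 hμ (Real.rpow_pos_of_pos hbase _) ?_ ?_
    · have h0 := hFpos _ hμ
      conv_rhs => rw [← hl2]
      rw [Real.sqrt_sq (by positivity)]
      field_simp
    · rw [← Real.rpow_mul hbase.le, one_div_mul_cancel hq.ne', Real.rpow_one]
      have := hμ.1
      field_simp
  · refine ContinuousOn.rpow_const (ContinuousOn.div continuousOn_const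
      ((continuousOn_id.mul hgc).mul continuousOn_const) fun l hl => (hpos l hl).ne')
      fun l _ => Or.inr hq'.le
  · intro l hl m hm hlm
    have h1 := hg hl hm hlm
    have hl0 := hA0.trans hl.1
    have h2 := (hgf l hl).1.1
    have h3 := hpos l hl
    dsimp only
    gcongr
    exact div_nonneg (by positivity) (hpos m hm).le
  · refine (tendsto_rpow_atTop hq').comp ?_
    have hden : Filter.Tendsto (fun l => l * g l * (p + 1)) (nhdsWithin A (Set.Ioi A))
        (nhdsWithin 0 (Set.Ioi 0)) := by
      refine tendsto_nhdsWithin_iff.2 ⟨?_, ?_⟩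
      · have := ((Filter.tendsto_id.mono_left nhdsWithin_le_nhds).mul hgA).mul_const (p + 1)
        simpa using this
      · filter_upwards [Ioo_mem_nhdsGT hAB] with l hl using hpos l hl
    simpa only [div_eq_mul_inv, Function.comp_def] using
      (tendsto_inv_nhdsGT_zero.comp hden).const_mul_atTop (show 0 < 2 * a by positivity)
  · have := ((Filter.tendsto_id.mono_left nhdsWithin_le_nhds).mul hgB).mul_const (p + 1)
    simp only [mul_one] at this
    exact (tendsto_const_nhds.div this (by positivity)).rpow_const (Or.inr hq'.le)
end
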